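/- Under the standard assumptions, if H_a is a Kuratowski subgraph of G avoiding a and b is not a branch vertex of H_a, then the induced subgraph G[C] is 2-connected. -/

import Mathlib

open SimpleGraph

/-- The complete graph on five vertices. -/
def K5 : SimpleGraph (Fin 5) := ⊤

/-- The complete bipartite graph `K_{3,3}`. -/
def K33 : SimpleGraph (Fin 6) :=
  SimpleGraph.fromRel (fun i j => i.val < 3 ∧ 3 ≤ j.val)

/-- `K_{3,3}` plus one extra edge joining two vertices in the same part. -/
def K33e : SimpleGraph (Fin 6) :=
  SimpleGraph.fromRel (fun i j => (i.val < 3 ∧ 3 ≤ j.val) ∨ (i.val = 0 ∧ j.val = 1))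

/-- `H` is a minor of `G`, witnessed by a family of nonempty, connected,
pairwise disjoint branch sets together with edges between the branch sets of
adjacent vertices of `H`. -/
def SimpleGraph.IsMinorOf {W V : Type} (H : SimpleGraph W) (G : SimpleGraph V) : Prop :=
  ∃ f : W → Set V,
    (∀ w, (G.induce (f w)).Connected) ∧
    (Pairwise fun w w' => Disjoint (f w) (f w')) ∧
    (∀ ⦃w w'⦄, H.Adj w w' → ∃ u ∈ f w, ∃ v ∈ f w', G.Adj u v)

/-- Planarity, via the Kuratowski–Wagner characterization: a (finite simple) graph is
planar iff it has no `K₅` minor and no `K_{3,3}` minor. -/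
def IsPlanar {V : Type} (G : SimpleGraph V) : Prop :=
  ¬ K5.IsMinorOf G ∧ ¬ K33.IsMinorOf G

/-- A graph is apex if it is planar or some vertex deletion makes it planar. -/
def IsApex {V : Type} (G : SimpleGraph V) : Prop :=
  IsPlanar G ∨ ∃ v : V, IsPlanar (G.induce {u | u ≠ v})

/-- `G` is an obstruction for the apex family: it is not apex, but every minor of it
that is not isomorphic to it is apex. -/
def IsApexObstruction {V : Type} (G : SimpleGraph V) : Prop :=
  ¬ IsApex G ∧
    ∀ (W : Type) (H : SimpleGraph W), H.IsMinorOf G → IsEmpty (H ≃g G) → IsApex H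

/-- Subdivide the edge `uv` of `G`: the new vertex is `none`. -/
def subdivideEdge {V : Type} (G : SimpleGraph V) (u v : V) : SimpleGraph (Option V) :=
  SimpleGraph.fromRel (fun x y =>
    (∃ a b, x = some a ∧ y = some b ∧ G.Adj a b ∧ s(a, b) ≠ s(u, v)) ∨
    (x = none ∧ (y = some u ∨ y = some v)))

/-- `IsSubdivision G H` : `H` is (isomorphic to) a graph obtained from `G` by repeatedly
subdividing edges. -/
inductive IsSubdivision : {V : Type} → SimpleGraph V → {W : Type} → SimpleGraph W → Prop
  | of_iso {V W : Type} {G : SimpleGraph V} {H : SimpleGraph W} :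
      (G ≃g H) → IsSubdivision G H
  | step {V W U : Type} {G : SimpleGraph V} {H : SimpleGraph W} {u v : W}
      {H' : SimpleGraph U} :
      H.Adj u v → IsSubdivision G H → (subdivideEdge H u v ≃g H') → IsSubdivision G H'

/-- A Kuratowski subgraph of `G` is a subgraph that is a subdivision of `K₅` or `K_{3,3}`. -/
def IsKuratowski {V : Type} {G : SimpleGraph V} (H : G.Subgraph) : Prop :=
  IsSubdivision K5 H.coe ∨ IsSubdivision K33 H.coe

/-- A Kuratowski witness for `v` is a Kuratowski subgraph of `G` avoiding `v`. -/
def IsKuratowskiWitness {V : Type} (G : SimpleGraph V) (v : V) (H : G.Subgraph) : Prop :=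
  IsKuratowski H ∧ v ∉ H.verts

/-- A branch vertex of a (Kuratowski) subgraph: a vertex of degree at least 3 in it. -/
def IsBranchVertex {V : Type} {G : SimpleGraph V} (H : G.Subgraph) (x : V) : Prop :=
  x ∈ H.verts ∧ 3 ≤ (H.neighborSet x).ncard

/-- The vertex connectivity of a finite graph: the largest `k` such that deleting any
fewer than `k` vertices leaves a connected graph. -/
noncomputable def vConn {V : Type} [Fintype V] (G : SimpleGraph V) : ℕ :=
  sSup {k : ℕ | ∀ s : Finset V, s.card < k → (G.induce ((↑s : Set V)ᶜ)).Connected}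

/-- A 2-cut: a set of two vertices whose deletion disconnects the graph. -/
def IsTwoCut {V : Type} (G : SimpleGraph V) (S : Set V) : Prop :=
  S.ncard = 2 ∧ ¬ (G.induce Sᶜ).Preconnected

/-- `C` is (the vertex set of) a connected component of `G − S`. -/
def IsCompOf {V : Type} (G : SimpleGraph V) (S : Set V) (C : Set V) : Prop :=
  C.Nonempty ∧ Disjoint C S ∧ (G.induce C).Connected ∧
    ∀ u ∈ C, ∀ v, v ∉ S → G.Adj u v → v ∈ C

/-- The augmented component `C⁺`: the subgraph induced by `C ∪ S` together with all
edges joining vertices of `S`. -/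
def augment {V : Type} (G : SimpleGraph V) (S C : Set V) : SimpleGraph ↥(C ∪ S) :=
  SimpleGraph.fromRel (fun u v => G.Adj (u : V) (v : V) ∨ ((u : V) ∈ S ∧ (v : V) ∈ S))

/-- `C` is a heavy component for the 2-cut `{a,b}`: a component of `G − {a,b}` whose
augmentation contains Kuratowski witnesses for both `a` and `b`. -/
def IsHeavyComp {V : Type} (G : SimpleGraph V) (a b : V) (C : Set V) : Prop :=
  IsCompOf G {a, b} C ∧
    (∃ Ha : G.Subgraph, IsKuratowskiWitness G a Ha ∧ Ha.verts ⊆ C ∪ {a, b}) ∧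
    (∃ Hb : G.Subgraph, IsKuratowskiWitness G b Hb ∧ Hb.verts ⊆ C ∪ {a, b})

/-- `{a,b}` is a basic 2-cut with heavy component `C`: a 2-cut whose heavy-component
weight is minimum among all 2-cuts. -/
def IsBasic2Cut {V : Type} (G : SimpleGraph V) (a b : V) (C : Set V) : Prop :=
  IsTwoCut G {a, b} ∧ IsHeavyComp G a b C ∧
    ∀ c d : V, ∀ D : Set V, IsTwoCut G {c, d} → IsHeavyComp G c d D → C.ncard ≤ D.ncard

/-- The subgraph of `G` induced by `A`, kept on the same vertex set (vertices outside `A`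
become isolated). -/
def restrictTo {V : Type} (G : SimpleGraph V) (A : Set V) : SimpleGraph V :=
  SimpleGraph.fromRel (fun u v => G.Adj u v ∧ u ∈ A ∧ v ∈ A)

/-- Contract the edge `uv` of `G`, keeping the label `u` for the merged vertex
(`v` becomes isolated). -/
def contractEdge {V : Type} (G : SimpleGraph V) (u v : V) : SimpleGraph V :=
  SimpleGraph.fromRel (fun x y =>
    x ≠ v ∧ y ≠ v ∧ (G.Adj x y ∨ (x = u ∧ G.Adj v y) ∨ (y = u ∧ G.Adj x v)))

/-- `T` separates `a` from `b` in `G`: `a, b ∉ T` and every walk from `a` to `b`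
meets `T`. -/
def Separates {V : Type} (G : SimpleGraph V) (T : Set V) (a b : V) : Prop :=
  a ∉ T ∧ b ∉ T ∧ ∀ p : G.Walk a b, ∃ t ∈ T, t ∈ p.support

/-- Disjoint union of two graphs. -/
def disjUnion {V W : Type} (G : SimpleGraph V) (H : SimpleGraph W) : SimpleGraph (V ⊕ W) :=
  SimpleGraph.fromRel (fun x y =>
    (∃ a b, x = Sum.inl a ∧ y = Sum.inl b ∧ G.Adj a b) ∨
    (∃ a b, x = Sum.inr a ∧ y = Sum.inr b ∧ H.Adj a b))

/-- The graph on `Fin n` with the given list of edges. -/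
def graphOfList (n : ℕ) (l : List (ℕ × ℕ)) : SimpleGraph (Fin n) :=
  SimpleGraph.fromRel (fun i j => ((i : ℕ), (j : ℕ)) ∈ l)

/-- A graph is 2-connected: at least three vertices and no cut vertex. -/
def IsTwoConnectedGraph {U : Type} (H : SimpleGraph U) : Prop :=
  3 ≤ Nat.card U ∧ ∀ u : U, (H.induce {x | x ≠ u}).Connected

section MinorModels

variable {V U W : Type}

/-- `S` is nonempty and every nonempty subset of `S` closed under adjacency inside `S` is all
of `S`. -/
def IsConnSet (G : SimpleGraph V) (S : Set V) : Prop :=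
  S.Nonempty ∧ ∀ T ⊆ S, T.Nonempty → (∀ u ∈ T, ∀ v ∈ S, G.Adj u v → v ∈ T) → S ⊆ T

theorem isConnSet_iff (G : SimpleGraph V) (S : Set V) :
    (G.induce S).Connected ↔ IsConnSet G S := by
  constructor
  · intro h
    obtain ⟨⟨s, hs⟩⟩ := h.nonempty
    refine ⟨⟨s, hs⟩, ?_⟩
    rintro T hTS ⟨t, ht⟩ hcl u hu
    obtain ⟨p⟩ := h.preconnected ⟨t, hTS ht⟩ ⟨u, hu⟩
    have key : ∀ (x y : S), (G.induce S).Walk x y → x.1 ∈ T → y.1 ∈ T := by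
      intro x y p
      induction p with
      | nil => exact id
      | cons hadj _ ih => exact fun hx => ih (hcl _ hx _ (Subtype.property _) hadj)
    exact key _ _ p ht
  · rintro ⟨⟨s, hs⟩, h⟩
    have : Nonempty S := ⟨⟨s, hs⟩⟩
    have key : ∀ x : S, (G.induce S).Reachable ⟨s, hs⟩ x := by
      have := h {x | ∃ hx : x ∈ S, (G.induce S).Reachable ⟨s, hs⟩ ⟨x, hx⟩}
        (fun x hx => hx.1) ⟨s, hs, Reachable.refl _⟩ (by
          rintro u ⟨hu, hr⟩ v hv huv
          refine ⟨hv, hr.trans (Adj.reachable ?_)⟩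
          exact huv)
      exact fun x => (this x.2).2
    exact ⟨fun x y => (key x).symm.trans (key y)⟩

theorem IsConnSet.singleton (G : SimpleGraph V) (u : V) : IsConnSet G {u} := by
  refine ⟨⟨u, rfl⟩, ?_⟩
  rintro T hT ⟨t, ht⟩ _ x rfl
  exact (hT ht) ▸ ht

theorem IsConnSet.insert {G : SimpleGraph V} {S : Set V} (hS : IsConnSet G S) {p : V}
    (hp : ∃ s ∈ S, G.Adj p s) : IsConnSet G (insert p S) := by
  obtain ⟨s, hs, hps⟩ := hp
  refine ⟨⟨p, .inl rfl⟩, ?_⟩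
  rintro T hT ⟨t, ht⟩ hcl
  have hsT : s ∈ T := by
    rcases hT ht with rfl | h
    · exact hcl _ ht _ (.inr hs) hps
    · exact hS.2 (T ∩ S) Set.inter_subset_right ⟨t, ht, h⟩
        (fun u hu v hv huv => ⟨hcl u hu.1 v (.inr hv) huv, hv⟩) hs |>.1
  have hST : S ⊆ T := fun x hx =>
    (hS.2 (T ∩ S) Set.inter_subset_right ⟨s, hsT, hs⟩
        (fun u hu v hv huv => ⟨hcl u hu.1 v (.inr hv) huv, hv⟩) hx).1
  rintro x (rfl | hx)
  · exact hcl s hsT _ (.inl rfl) hps.symm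
  · exact hST hx

/-- Connectivity of a set only depends on the edges inside it. -/
theorem IsConnSet.mono {G H : SimpleGraph V} {S : Set V} (hS : IsConnSet G S)
    (h : ∀ u ∈ S, ∀ v ∈ S, G.Adj u v → H.Adj u v) : IsConnSet H S :=
  ⟨hS.1, fun T hT hne hcl => hS.2 T hT hne fun u hu v hv huv =>
    hcl u hu v hv (h u (hT hu) v hv huv)⟩

/-- A connected set meeting `T` and closed out of `T` is contained in `T`. -/
theorem IsConnSet.subset_of_closed {G : SimpleGraph V} {S T : Set V} (hS : IsConnSet G S)
    {t : V} (htS : t ∈ S) (htT : t ∈ T)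
    (hcl : ∀ u ∈ T, u ∈ S → ∀ v ∈ S, G.Adj u v → v ∈ T) : S ⊆ T := fun _ hx =>
  (hS.2 (T ∩ S) Set.inter_subset_right ⟨t, htT, htS⟩
    (fun u hu v hv huv => ⟨hcl u hu.1 hu.2 v hv huv, hv⟩) hx).1

theorem exists_component (G : SimpleGraph V) {X : Set V} {p : V} (hp : p ∈ X) :
    ∃ D ⊆ X, p ∈ D ∧ IsConnSet G D ∧ ∀ u ∈ D, ∀ v ∈ X, G.Adj u v → v ∈ D := by
  let r : V → V → Prop := fun u v => G.Adj u v ∧ u ∈ X ∧ v ∈ X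
  have hX : ∀ u, Relation.ReflTransGen r p u → u ∈ X := by
    intro u hu
    induction hu with
    | refl => exact hp
    | tail _ h _ => exact h.2.2
  refine ⟨{u | Relation.ReflTransGen r p u}, hX, .refl, ⟨⟨p, .refl⟩, ?_⟩,
    fun u hu v hv huv => hu.tail ⟨huv, hX u hu, hv⟩⟩
  rintro T hT ⟨t, ht⟩ hcl
  have hback : ∀ t, Relation.ReflTransGen r p t → t ∈ T → p ∈ T := by
    intro t h
    induction h with
    | refl => exact id
    | tail h1 h2 ih => exact fun h => ih (hcl _ h _ h1 h2.1.symm)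
  have hpT := hback t (hT ht) ht
  intro x hx
  induction hx with
  | refl => exact hpT
  | tail h1 h2 ih => exact hcl _ ih _ (h1.tail h2) h2.1

theorem restrictTo_adj {G : SimpleGraph V} {A : Set V} {u v : V} :
    (restrictTo G A).Adj u v ↔ G.Adj u v ∧ u ∈ A ∧ v ∈ A := by
  simp only [restrictTo, fromRel_adj]
  constructor
  · rintro ⟨_, h | h⟩
    · exact h
    · exact ⟨h.1.symm, h.2.2, h.2.1⟩
  · exact fun h => ⟨h.1.ne, .inl h⟩

/-- A minor model of `K` in `H`. -/
def HasModel (K : SimpleGraph W) (H : SimpleGraph V) : Prop :=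
  ∃ f : W → Set V, (∀ w, IsConnSet H (f w)) ∧
    (∀ w w', w ≠ w' → Disjoint (f w) (f w')) ∧
    (∀ w w', K.Adj w w' → ∃ u ∈ f w, ∃ v ∈ f w', H.Adj u v)

theorem isMinorOf_iff (K : SimpleGraph W) (H : SimpleGraph V) :
    K.IsMinorOf H ↔ HasModel K H := by
  constructor
  · rintro ⟨f, h1, h2, h3⟩
    exact ⟨f, fun w => (isConnSet_iff _ _).1 (h1 w), fun w w' h => h2 h, fun w w' h => h3 h⟩
  · rintro ⟨f, h1, h2, h3⟩
    exact ⟨f, fun w => (isConnSet_iff _ _).2 (h1 w), fun w w' h => h2 w w' h,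
      fun w w' h => h3 w w' h⟩

/-- A robust form of 3-connectedness, shared by `K₅` and `K_{3,3}`: after deleting two vertices
the diameter is at most two. -/
structure IsRobust (K : SimpleGraph W) : Prop where
  near : ∀ p q u v : W, u ≠ p → u ≠ q → v ≠ p → v ≠ q → u ≠ v →
    K.Adj u v ∨ ∃ z, z ≠ p ∧ z ≠ q ∧ K.Adj u z ∧ K.Adj z v
  three_neighbors : ∀ w p q : W, ∃ z, z ≠ p ∧ z ≠ q ∧ K.Adj w z
  five : ∃ e : Fin 5 → W, Function.Injective e

theorem isRobust_K5 : IsRobust K5 where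
  near := by intro p q u v _ _ _ _ h; exact .inl h
  three_neighbors := by
    simp only [K5, top_adj]; decide
  five := ⟨id, Function.injective_id⟩

theorem K33_adj (u v : Fin 6) : K33.Adj u v ↔ ¬ (u < 3 ↔ v < 3) := by
  simp only [K33, fromRel_adj]
  revert u v
  decide

theorem isRobust_K33 : IsRobust K33 where
  near := by
    simp only [K33_adj]; decide
  three_neighbors := by
    simp only [K33_adj]; decide
  five := ⟨Fin.castSucc, Fin.castSucc_injective 5⟩

theorem IsRobust.exists_adj {K : SimpleGraph W} (hK : IsRobust K) (w : W) : ∃ z, K.Adj w z :=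
  let ⟨z, _, _, h⟩ := hK.three_neighbors w w w
  ⟨z, h⟩

theorem model_mem_support {K : SimpleGraph W} (hK : IsRobust K) {H : SimpleGraph V}
    {f : W → Set V} (h1 : ∀ w, IsConnSet H (f w))
    (h3 : ∀ w w', K.Adj w w' → ∃ u ∈ f w, ∃ v ∈ f w', H.Adj u v) {w : W} {u : V}
    (hu : u ∈ f w) : ∃ v, H.Adj u v := by
  by_contra! hno
  obtain ⟨z, hz⟩ := hK.exists_adj w
  obtain ⟨s, hs, t, ht, hst⟩ := h3 w z hz
  have : s ∈ ({u} : Set V) := (h1 w).2 {u} (by simpa using hu) ⟨u, rfl⟩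
    (by rintro _ rfl v _ h; exact (hno v h).elim) hs
  rw [Set.mem_singleton_iff] at this
  exact hno t (this ▸ hst)

theorem HasModel.trans {K : SimpleGraph W} (hK : IsRobust K) {H : SimpleGraph V}
    {G : SimpleGraph U} (hH : HasModel K H) (S : Set V) (hS : ∀ u v, H.Adj u v → u ∈ S)
    (g : V → Set U) (hg : ∀ u ∈ S, IsConnSet G (g u))
    (hd : ∀ u ∈ S, ∀ v ∈ S, u ≠ v → Disjoint (g u) (g v))
    (ha : ∀ u v, H.Adj u v → ∃ s ∈ g u, ∃ t ∈ g v, G.Adj s t) : HasModel K G := by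
  obtain ⟨f, h1, h2, h3⟩ := hH
  have hfS : ∀ w, ∀ u ∈ f w, u ∈ S := fun w u hu => by
    obtain ⟨v, hv⟩ := model_mem_support hK h1 h3 hu
    exact hS u v hv
  refine ⟨fun w => ⋃ u ∈ f w, g u, fun w => ⟨?_, ?_⟩, ?_, ?_⟩
  · obtain ⟨u, hu⟩ := (h1 w).1
    obtain ⟨s, hs⟩ := (hg u (hfS w u hu)).1
    exact ⟨s, Set.mem_biUnion hu hs⟩
  · rintro T hT ⟨t, ht⟩ hcl
    have hfull : ∀ u ∈ f w, (∃ s ∈ g u, s ∈ T) → g u ⊆ T := by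
      rintro u hu ⟨s, hs, hsT⟩
      refine (hg u (hfS w u hu)).subset_of_closed hs hsT fun x hx _ y hy hxy => ?_
      exact hcl x hx y (Set.mem_biUnion hu hy) hxy
    obtain ⟨u0, hu0, ht0⟩ := Set.mem_iUnion₂.1 (hT ht)
    have : f w ⊆ {u | g u ⊆ T} := by
      refine (h1 w).subset_of_closed hu0 (hfull u0 hu0 ⟨t, ht0, ht⟩) fun u hu hu' v hv huv => ?_
      obtain ⟨s, hs, t, ht, hst⟩ := ha u v huv
      exact hfull v hv ⟨t, ht, hcl s (hu hs) t (Set.mem_biUnion hv ht) hst⟩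
    exact Set.iUnion₂_subset fun u hu => this hu
  · intro w w' hne
    rw [Set.disjoint_left]
    intro s hs hs'
    obtain ⟨u, hu, hsu⟩ := Set.mem_iUnion₂.1 hs
    obtain ⟨v, hv, hsv⟩ := Set.mem_iUnion₂.1 hs'
    have huv : u ≠ v := by
      rintro rfl
      exact Set.disjoint_left.1 (h2 w w' hne) hu hv
    exact Set.disjoint_left.1 (hd u (hfS w u hu) v (hfS w' v hv) huv) hsu hsv
  · intro w w' hww
    obtain ⟨u, hu, v, hv, huv⟩ := h3 w w' hww
    obtain ⟨s, hs, t, ht, hst⟩ := ha u v huv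
    exact ⟨s, Set.mem_biUnion hu hs, t, Set.mem_biUnion hv ht, hst⟩

theorem HasModel.refl (K : SimpleGraph W) : HasModel K K :=
  ⟨fun w => {w}, fun w => .singleton K w, fun w w' h => by simpa using h,
    fun w w' h => ⟨w, rfl, w', rfl, h⟩⟩

/-- The side of a separation of order at most two which contains the bulk of a model keeps
the model, once the separator is made a clique. -/
theorem model_of_side {K : SimpleGraph W} {H : SimpleGraph V} {P Q : Set V} {p q : V}
    (hPQ : ∀ u, u ∈ P ∨ u ∈ Q) (hS : ∀ u, u ∈ P → u ∈ Q → u = p ∨ u = q)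
    (hno : ∀ u v, u ∉ Q → v ∉ P → ¬ H.Adj u v)
    {f : W → Set V} (h1 : ∀ w, IsConnSet H (f w))
    (h2 : ∀ w w', w ≠ w' → Disjoint (f w) (f w'))
    (h3 : ∀ w w', K.Adj w w' → ∃ u ∈ f w, ∃ v ∈ f w', H.Adj u v)
    (hf : ∀ w, (∃ s ∈ f w, s ∈ P ∧ s ∈ Q) ∨ ∀ s ∈ f w, s ∉ Q) :
    HasModel K (restrictTo H P ⊔ edge p q) := by
  have hclique : ∀ s t, s ∈ P → s ∈ Q → t ∈ P → t ∈ Q → s ≠ t →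
      (restrictTo H P ⊔ edge p q).Adj s t := by
    intro s t hs hs' ht ht' hst
    rw [sup_adj, edge_adj]
    rcases hS s hs hs' with rfl | rfl <;> rcases hS t ht ht' with rfl | rfl <;> simp_all
  refine ⟨fun w => f w ∩ P, fun w => ?_, fun w w' h => ?_, fun w w' h => ?_⟩
  · rcases hf w with ⟨s, hsf, hsP, hsQ⟩ | hsub
    · refine ⟨⟨s, hsf, hsP⟩, ?_⟩
      rintro T hT ⟨t, ht⟩ hcl
      have hclH : ∀ u ∈ T, ∀ v ∈ f w, v ∈ P → H.Adj u v → v ∈ T := fun u hu v hv hvP huv =>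
        hcl u hu v ⟨hv, hvP⟩ (.inl (restrictTo_adj.2 ⟨huv, (hT hu).2, hvP⟩))
      have hmeet : ∃ r ∈ T, r ∈ Q := by
        by_contra! hcon
        exact hcon s ((h1 w).2 T (fun x hx => (hT hx).1) ⟨t, ht⟩
          (fun u hu v hv huv => hclH u hu v hv
            (by by_contra hvP; exact hno u v (hcon u hu) hvP huv) huv) hsf) hsQ
      obtain ⟨r, hrT, hrQ⟩ := hmeet
      have hST : ∀ x ∈ f w, x ∈ P → x ∈ Q → x ∈ T := by
        intro x hx hxP hxQ
        by_cases hrx : r = x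
        · exact hrx ▸ hrT
        · exact hcl r hrT x ⟨hx, hxP⟩ (hclique r x (hT hrT).2 hrQ hxP hxQ hrx)
      have := (h1 w).subset_of_closed (T := T ∪ Pᶜ) (hT ht).1 (.inl ht) (by
        rintro u (hu | hu) huf v hv huv
        · by_cases hvP : v ∈ P
          · exact .inl (hclH u hu v hv hvP huv)
          · exact .inr hvP
        · by_cases hvP : v ∈ P
          · refine .inl (hST v hv hvP ?_)
            by_contra hvQ
            exact hno v u hvQ hu huv.symm
          · exact .inr hvP)
      rintro x ⟨hx, hxP⟩
      exact (this hx).resolve_right (fun h => h hxP)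
    · have hP : f w ⊆ P := fun x hx => (hPQ x).resolve_right (hsub x hx)
      change IsConnSet _ (f w ∩ P)
      rw [Set.inter_eq_left.2 hP]
      exact (h1 w).mono fun u hu v hv huv => .inl (restrictTo_adj.2 ⟨huv, hP hu, hP hv⟩)
  · exact (h2 w w' h).mono Set.inter_subset_left Set.inter_subset_left
  · have aux : ∀ w w' : W, w ≠ w' → ∀ u ∈ f w, ∀ v ∈ f w', H.Adj u v → u ∉ P →
        ∃ s ∈ f w ∩ P, ∃ t ∈ f w' ∩ P, (restrictTo H P ⊔ edge p q).Adj s t := by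
      intro w w' hne u hu v hv huv huP
      have huQ := (hPQ u).resolve_left huP
      have hvQ : v ∈ Q := by
        by_contra hvQ
        exact hno v u hvQ huP huv.symm
      obtain ⟨s, hs, hsP, hsQ⟩ := (hf w).resolve_right (fun h => h u hu huQ)
      obtain ⟨t, ht, htP, htQ⟩ := (hf w').resolve_right (fun h => h v hv hvQ)
      refine ⟨s, ⟨hs, hsP⟩, t, ⟨ht, htP⟩, hclique s t hsP hsQ htP htQ ?_⟩
      rintro rfl
      exact Set.disjoint_left.1 (h2 w w' hne) hs ht
    obtain ⟨u, hu, v, hv, huv⟩ := h3 w w' h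
    by_cases huP : u ∈ P
    · by_cases hvP : v ∈ P
      · exact ⟨u, ⟨hu, huP⟩, v, ⟨hv, hvP⟩, .inl (restrictTo_adj.2 ⟨huv, huP, hvP⟩)⟩
      · obtain ⟨s, hs, t, ht, hst⟩ := aux w' w h.ne.symm v hv u hu huv.symm hvP
        exact ⟨t, ht, s, hs, hst.symm⟩
    · exact aux w w' h.ne u hu v hv huv huP

theorem exists_owner [Nonempty W] {f : W → Set V}
    (h2 : ∀ w w', w ≠ w' → Disjoint (f w) (f w')) (p : V) : ∃ w0, ∀ w, p ∈ f w → w = w0 := by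
  by_cases h : ∃ w, p ∈ f w
  · obtain ⟨w0, h0⟩ := h
    refine ⟨w0, fun w hw => ?_⟩
    by_contra hne
    exact Set.disjoint_left.1 (h2 w w0 hne) hw h0
  · exact ⟨Classical.arbitrary W, fun w hw => (h ⟨w, hw⟩).elim⟩

theorem HasModel.split {K : SimpleGraph W} (hK : IsRobust K) {H : SimpleGraph V} {P Q : Set V}
    {p q : V} (hPQ : ∀ u, u ∈ P ∨ u ∈ Q) (hS : ∀ u, u ∈ P → u ∈ Q → u = p ∨ u = q)
    (hno : ∀ u v, u ∉ Q → v ∉ P → ¬ H.Adj u v) (hH : HasModel K H) :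
    HasModel K (restrictTo H P ⊔ edge p q) ∨ HasModel K (restrictTo H Q ⊔ edge p q) := by
  obtain ⟨f, h1, h2, h3⟩ := hH
  have : Nonempty W := hK.five.elim fun e _ => ⟨e 0⟩
  obtain ⟨p', hp'⟩ := exists_owner h2 p
  obtain ⟨q', hq'⟩ := exists_owner h2 q
  have hside : ∀ w, (∃ s ∈ f w, s ∈ P ∧ s ∈ Q) ∨ (∀ s ∈ f w, s ∉ Q) ∨ ∀ s ∈ f w, s ∉ P := by
    intro w
    by_contra! hcon
    obtain ⟨hc1, ⟨s, hs, hsQ⟩, ⟨t, ht, htP⟩⟩ := hcon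
    refine hc1 s hs ((h1 w).subset_of_closed (T := P) ht htP ?_ hs) hsQ
    intro u hu huf v hv huv
    by_contra hvP
    exact hno u v (hc1 u huf hu) hvP huv
  have hoff : ∀ w, w ≠ p' → w ≠ q' → ¬ ∃ s ∈ f w, s ∈ P ∧ s ∈ Q := by
    rintro w hwp hwq ⟨s, hs, hsP, hsQ⟩
    rcases hS s hsP hsQ with rfl | rfl
    · exact hwp (hp' w hs)
    · exact hwq (hq' w hs)
  have hadjQ : ∀ w w', K.Adj w w' → (∀ s ∈ f w, s ∉ Q) →
      (∃ s ∈ f w', s ∈ P ∧ s ∈ Q) ∨ ∀ s ∈ f w', s ∉ Q := by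
    intro w w' hw hwQ
    rcases hside w' with h | h | h
    · exact .inl h
    · exact .inr h
    · obtain ⟨u, hu, v, hv, huv⟩ := h3 w w' hw
      exact (hno u v (hwQ u hu) (h v hv) huv).elim
  have hadjP : ∀ w w', K.Adj w w' → (∀ s ∈ f w, s ∉ P) →
      (∃ s ∈ f w', s ∈ Q ∧ s ∈ P) ∨ ∀ s ∈ f w', s ∉ P := by
    intro w w' hw hwQ
    rcases hside w' with ⟨s, h⟩ | h | h
    · exact .inl ⟨s, h.1, h.2.2, h.2.1⟩
    · obtain ⟨u, hu, v, hv, huv⟩ := h3 w w' hw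
      exact (hno v u (h v hv) (hwQ u hu) huv.symm).elim
    · exact .inr h
  obtain ⟨w0, hw0p, hw0q, -⟩ := hK.three_neighbors p' p' q'
  rcases (hside w0).resolve_left (hoff w0 hw0p hw0q) with h0 | h0
  · left
    have hall : ∀ w, w ≠ p' → w ≠ q' → ∀ s ∈ f w, s ∉ Q := by
      intro w hwp hwq
      by_cases hw : w0 = w
      · exact hw ▸ h0
      · rcases hK.near p' q' w0 w hw0p hw0q hwp hwq hw with h | ⟨z, hzp, hzq, hz1, hz2⟩
        · exact (hadjQ w0 w h h0).resolve_left (hoff w hwp hwq)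
        · exact (hadjQ z w hz2 ((hadjQ w0 z hz1 h0).resolve_left
            (hoff z hzp hzq))).resolve_left (hoff w hwp hwq)
    refine model_of_side hPQ hS hno h1 h2 h3 fun w => ?_
    obtain ⟨z, hzp, hzq, hz⟩ := hK.three_neighbors w p' q'
    exact hadjQ z w hz.symm (hall z hzp hzq)
  · right
    have hoff' : ∀ w, w ≠ p' → w ≠ q' → ¬ ∃ s ∈ f w, s ∈ Q ∧ s ∈ P :=
      fun w h h' ⟨s, hs, h1, h2⟩ => hoff w h h' ⟨s, hs, h2, h1⟩
    have hall : ∀ w, w ≠ p' → w ≠ q' → ∀ s ∈ f w, s ∉ P := by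
      intro w hwp hwq
      by_cases hw : w0 = w
      · exact hw ▸ h0
      · rcases hK.near p' q' w0 w hw0p hw0q hwp hwq hw with h | ⟨z, hzp, hzq, hz1, hz2⟩
        · exact (hadjP w0 w h h0).resolve_left (hoff' w hwp hwq)
        · exact (hadjP z w hz2 ((hadjP w0 z hz1 h0).resolve_left
            (hoff' z hzp hzq))).resolve_left (hoff' w hwp hwq)
    refine model_of_side (fun u => (hPQ u).symm) (fun u h h' => hS u h' h)
      (fun u v hu hv huv => hno v u hv hu huv.symm) h1 h2 h3 fun w => ?_
    obtain ⟨z, hzp, hzq, hz⟩ := hK.three_neighbors w p' q'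
    exact hadjP z w hz.symm (hall z hzp hzq)

/-- Suppressing a vertex with at most two neighbours keeps a model. -/
theorem HasModel.suppress {K : SimpleGraph W} (hK : IsRobust K) {H : SimpleGraph V} {b x y : V}
    (hb : ∀ u, H.Adj b u → u = x ∨ u = y) (hH : HasModel K H) :
    HasModel K (restrictTo H {b}ᶜ ⊔ edge x y) := by
  obtain ⟨f, h1, h2, h3⟩ := hH
  have : Nonempty W := hK.five.elim fun e _ => ⟨e 0⟩
  obtain ⟨p', hp'⟩ := exists_owner h2 x
  obtain ⟨q', hq'⟩ := exists_owner h2 y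
  have hne : ∀ w, ∃ s ∈ f w, s ≠ b := by
    intro w
    by_contra! hcon
    obtain ⟨z, hzp, hzq, hz⟩ := hK.three_neighbors w p' q'
    obtain ⟨u, hu, v, hv, huv⟩ := h3 w z hz
    rw [hcon u hu] at huv
    rcases hb v huv with rfl | rfl
    · exact hzp (hp' z hv)
    · exact hzq (hq' z hv)
  have hin : ∀ {u v}, H.Adj u v → u ≠ b → v ≠ b → (restrictTo H {b}ᶜ ⊔ edge x y).Adj u v :=
    fun h hu hv => .inl (restrictTo_adj.2 ⟨h, hu, hv⟩)
  have hxy : ∀ {u v}, H.Adj b u → H.Adj b v → u ≠ v →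
      (restrictTo H {b}ᶜ ⊔ edge x y).Adj u v := by
    intro u v hu hv huv
    rw [sup_adj, edge_adj]
    rcases hb u hu with rfl | rfl <;> rcases hb v hv with rfl | rfl <;> simp_all
  refine ⟨fun w => f w \ {b}, fun w => ⟨?_, ?_⟩, fun w w' h => ?_, fun w w' h => ?_⟩
  · obtain ⟨s, hs, hsb⟩ := hne w
    exact ⟨s, hs, hsb⟩
  · rintro T hT ⟨t, ht⟩ hcl
    by_cases hadj : b ∈ f w ∧ ∃ s ∈ T, H.Adj s b
    · obtain ⟨hbf, s, hsT, hsb⟩ := hadj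
      have := (h1 w).subset_of_closed (T := insert b T) hbf (.inl rfl) (by
        rintro u (rfl | hu) huf v hv huv
        · by_cases hsv : s = v
          · exact .inr (hsv ▸ hsT)
          · exact .inr (hcl s hsT v ⟨hv, huv.ne.symm⟩ (hxy hsb.symm huv hsv))
        · by_cases hvb : v = b
          · exact .inl hvb
          · exact .inr (hcl u hu v ⟨hv, hvb⟩ (hin huv (hT hu).2 hvb)))
      rintro z ⟨hz, hzb⟩
      exact (this hz).resolve_left hzb
    · have := (h1 w).2 T (fun z hz => (hT hz).1) ⟨t, ht⟩ (fun u hu v hv huv => by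
        by_cases hvb : v = b
        · exact (hadj ⟨hvb ▸ hv, u, hu, hvb ▸ huv⟩).elim
        · exact hcl u hu v ⟨hv, hvb⟩ (hin huv (hT hu).2 hvb))
      exact fun z hz => this hz.1
  · exact (h2 w w' h).mono Set.sdiff_subset Set.sdiff_subset
  · have aux : ∀ w w' : W, w ≠ w' → b ∈ f w → ∀ v ∈ f w', H.Adj b v →
        ∃ s ∈ f w \ {b}, ∃ t ∈ f w' \ {b}, (restrictTo H {b}ᶜ ⊔ edge x y).Adj s t := by
      intro w w' hww hbw v hv hbv
      obtain ⟨s, hs, hbs⟩ : ∃ s ∈ f w, H.Adj b s := by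
        by_contra! hcon
        obtain ⟨s, hs, hsb⟩ := hne w
        exact hsb ((h1 w).2 {b} (by simpa using hbw) ⟨b, rfl⟩
          (by rintro _ rfl z hz h; exact (hcon z hz h).elim) hs)
      refine ⟨s, ⟨hs, hbs.ne.symm⟩, v, ⟨hv, hbv.ne.symm⟩, hxy hbs hbv ?_⟩
      rintro rfl
      exact Set.disjoint_left.1 (h2 w w' hww) hs hv
    obtain ⟨u, hu, v, hv, huv⟩ := h3 w w' h
    by_cases hub : u = b
    · subst hub
      exact aux w w' h.ne hu v hv huv
    · by_cases hvb : v = b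
      · subst hvb
        obtain ⟨s, hs, t, ht, hst⟩ := aux w' w h.ne.symm hv u hu huv.symm
        exact ⟨t, ht, s, hs, hst.symm⟩
      · exact ⟨u, ⟨hu, hub⟩, v, ⟨hv, hvb⟩, hin huv hub hvb⟩

theorem HasModel.five_le {K : SimpleGraph W} (hK : IsRobust K) {H : SimpleGraph V}
    (hH : HasModel K H) {X : Set V} (hfin : X.Finite) (hX : ∀ u v, H.Adj u v → u ∈ X) :
    5 ≤ X.ncard := by
  obtain ⟨f, h1, h2, h3⟩ := hH
  obtain ⟨e, he⟩ := hK.five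
  choose c hc using fun w => (h1 w).1
  have hinj : Function.Injective (fun i => c (e i)) := by
    intro i j hij
    by_contra hne
    have := h2 (e i) (e j) (fun h => hne (he h))
    exact Set.disjoint_left.1 this (hc (e i)) (by simpa [hij] using hc (e j))
  have hsub : Set.range (fun i => c (e i)) ⊆ X := by
    rintro _ ⟨i, rfl⟩
    obtain ⟨v, hv⟩ := model_mem_support hK h1 h3 (hc (e i))
    exact hX _ v hv
  calc 5 = (Set.range (fun i => c (e i))).ncard := by
        rw [← Set.image_univ, Set.ncard_image_of_injective _ hinj]; simp
    _ ≤ X.ncard := Set.ncard_le_ncard hsub hfin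

theorem IsSubdivision.hasModel {K : SimpleGraph W} {H : SimpleGraph V} (h : IsSubdivision K H)
    (hK : IsRobust K) : HasModel K H := by
  induction h with
  | of_iso φ =>
    refine (HasModel.refl _).trans hK Set.univ (fun _ _ _ => trivial) (fun u => {φ u})
      (fun u _ => .singleton _ _) (fun u _ v _ huv => ?_) (fun u v huv => ?_)
    · simpa using huv
    · exact ⟨_, rfl, _, rfl, φ.map_rel_iff.2 huv⟩
  | @step V₁ V₂ K H u v H₂ huv _ φ ih =>
    classical
    have h1 : (subdivideEdge H u v).Adj none (some u) := by
      simp [subdivideEdge]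
    have h2 : (subdivideEdge H u v).Adj none (some v) := by
      simp [subdivideEdge]
    refine (ih hK).trans hK Set.univ (fun _ _ _ => trivial)
      (fun s => if s = u then {φ none, φ (some u)} else {φ (some s)}) (fun s _ => ?_)
      (fun s _ t _ hst => ?_) (fun s t hst => ?_)
    · split_ifs
      · exact (IsConnSet.singleton _ _).insert ⟨_, rfl, φ.map_rel_iff.2 h1⟩
      · exact .singleton _ _
    · split_ifs with hs ht ht
      · exact (hst (hs.trans ht.symm)).elim
      · subst hs; simp [Ne.symm hst]
      · subst ht; simp [hst]
      · simpa using hst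
    · have hmem : ∀ r, φ (some r) ∈
          (if r = u then {φ none, φ (some u)} else {φ (some r)} : Set V₂) := by
        intro r; split_ifs with hr
        · subst hr; simp
        · rfl
      have hu : φ none ∈
          (if u = u then {φ none, φ (some u)} else {φ (some u)} : Set V₂) := by simp
      by_cases he : s(s, t) = s(u, v)
      · rcases Sym2.eq_iff.1 he with ⟨rfl, rfl⟩ | ⟨rfl, rfl⟩
        · exact ⟨_, hu, _, hmem _, φ.map_rel_iff.2 h2⟩
        · exact ⟨_, hmem _, _, hu, φ.map_rel_iff.2 h2.symm⟩
      · refine ⟨_, hmem s, _, hmem t, φ.map_rel_iff.2 ?_⟩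
        simp only [subdivideEdge, fromRel_adj]
        exact ⟨by simpa using hst.ne, .inl (.inl ⟨s, t, rfl, rfl, hst, he⟩)⟩

end MinorModels

section NonPlanar

variable {V U : Type}

/-- The graph has a `K₅` or a `K_{3,3}` minor. -/
def NonPlanar (H : SimpleGraph V) : Prop := HasModel K5 H ∨ HasModel K33 H

theorem not_isPlanar_iff (H : SimpleGraph V) : ¬ IsPlanar H ↔ NonPlanar H := by
  rw [IsPlanar, isMinorOf_iff, isMinorOf_iff, NonPlanar]
  tauto

theorem NonPlanar.trans {H : SimpleGraph V} {G : SimpleGraph U} (hH : NonPlanar H) (S : Set V)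
    (hS : ∀ u v, H.Adj u v → u ∈ S) (g : V → Set U) (hg : ∀ u ∈ S, IsConnSet G (g u))
    (hd : ∀ u ∈ S, ∀ v ∈ S, u ≠ v → Disjoint (g u) (g v))
    (ha : ∀ u v, H.Adj u v → ∃ s ∈ g u, ∃ t ∈ g v, G.Adj s t) : NonPlanar G :=
  hH.imp (fun h => h.trans isRobust_K5 S hS g hg hd ha)
    (fun h => h.trans isRobust_K33 S hS g hg hd ha)

theorem NonPlanar.map {H : SimpleGraph V} {G : SimpleGraph U} (hH : NonPlanar H) {e : V → U}
    (he : Function.Injective e) (h : ∀ u v, H.Adj u v → G.Adj (e u) (e v)) : NonPlanar G :=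
  hH.trans Set.univ (fun _ _ _ => trivial) (fun u => {e u}) (fun _ _ => .singleton _ _)
    (fun u _ v _ huv => by simpa using he.ne huv)
    (fun u v huv => ⟨_, rfl, _, rfl, h u v huv⟩)

theorem NonPlanar.mono {H G : SimpleGraph V} (hH : NonPlanar H)
    (h : ∀ u v, H.Adj u v → G.Adj u v) : NonPlanar G :=
  hH.map Function.injective_id h

theorem NonPlanar.comap {H : SimpleGraph V} {G : SimpleGraph U} (hH : NonPlanar H) {e : U → V}
    (he : Function.Injective e)
    (h : ∀ u v, H.Adj u v → ∃ u' v', e u' = u ∧ e v' = v ∧ G.Adj u' v') : NonPlanar G := by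
  refine hH.trans (Set.range e) (fun u v huv => ?_) (fun u => e ⁻¹' {u}) ?_
    (fun u _ v _ huv => ?_) (fun u v huv => ?_)
  · obtain ⟨u', _, rfl, -⟩ := h u v huv
    exact ⟨u', rfl⟩
  · rintro _ ⟨u, rfl⟩
    have : e ⁻¹' {e u} = {u} := by ext; simp [he.eq_iff]
    rw [this]
    exact .singleton _ _
  · exact Disjoint.preimage e (by simpa using huv)
  · obtain ⟨u', v', rfl, rfl, h'⟩ := h u v huv
    exact ⟨u', rfl, v', rfl, h'⟩

theorem NonPlanar.split {H : SimpleGraph V} (hH : NonPlanar H) (P Q : Set V) (p q : V)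
    (hPQ : ∀ u, u ∈ P ∨ u ∈ Q) (hS : ∀ u, u ∈ P → u ∈ Q → u = p ∨ u = q)
    (hno : ∀ u v, u ∉ Q → v ∉ P → ¬ H.Adj u v) :
    NonPlanar (restrictTo H P ⊔ edge p q) ∨ NonPlanar (restrictTo H Q ⊔ edge p q) := by
  rcases hH with h | h
  · exact (h.split isRobust_K5 hPQ hS hno).imp .inl .inl
  · exact (h.split isRobust_K33 hPQ hS hno).imp .inr .inr

theorem NonPlanar.suppress {H : SimpleGraph V} (hH : NonPlanar H) {b x y : V}
    (hb : ∀ u, H.Adj b u → u = x ∨ u = y) : NonPlanar (restrictTo H {b}ᶜ ⊔ edge x y) :=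
  hH.imp (fun h => h.suppress isRobust_K5 hb) (fun h => h.suppress isRobust_K33 hb)

theorem NonPlanar.five_le {H : SimpleGraph V} (hH : NonPlanar H) {X : Set V} (hfin : X.Finite)
    (hX : ∀ u v, H.Adj u v → u ∈ X) : 5 ≤ X.ncard :=
  hH.elim (fun h => h.five_le isRobust_K5 hfin hX) (fun h => h.five_le isRobust_K33 hfin hX)

theorem NonPlanar.exists_adj {H : SimpleGraph V} (hH : NonPlanar H) : ∃ u v, H.Adj u v := by
  by_contra! hno
  have := hH.five_le (X := ∅) Set.finite_empty (fun u v h => (hno u v h).elim)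
  simp at this

/-- An edge `pq` may be replaced by a connected set `E` containing `q` and adjacent to `p`. -/
theorem NonPlanar.absorb {F F' : SimpleGraph V} {E : Set V} {p q : V}
    (h : NonPlanar (F ⊔ edge p q)) (hFE : ∀ u w, F.Adj u w → u ∈ E → u = q)
    (hle : ∀ u w, F.Adj u w → F'.Adj u w) (hE : IsConnSet F' E) (hq : q ∈ E) (hp : p ∉ E)
    (hpE : ∃ d ∈ E, F'.Adj p d) : NonPlanar F' := by
  classical
  obtain ⟨d, hd, hpd⟩ := hpE
  have hpq : p ≠ q := fun h => hp (h ▸ hq)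
  have hmem : ∀ u, u ∈ (if u = q then E else {u} : Set V) := by
    intro u; split_ifs with h
    · exact h ▸ hq
    · rfl
  refine h.trans {u | u ∈ E → u = q} (fun u v huv => ?_) (fun u => if u = q then E else {u})
    (fun u _ => ?_) (fun u hu v hv huv => ?_) (fun u v huv => ?_)
  · rw [sup_adj, edge_adj] at huv
    rcases huv with huv | ⟨⟨rfl, rfl⟩ | ⟨rfl, rfl⟩, _⟩
    · exact hFE u v huv
    · exact fun h => (hp h).elim
    · exact fun _ => rfl
  · split_ifs
    · exact hE
    · exact .singleton _ _
  · split_ifs with h1 h2 h2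
    · exact (huv (h1.trans h2.symm)).elim
    · simpa using fun h => h2 (hv h)
    · simpa using fun h => h1 (hu h)
    · simpa using huv
  · rw [sup_adj, edge_adj] at huv
    rcases huv with huv | ⟨⟨rfl, rfl⟩ | ⟨rfl, rfl⟩, _⟩
    · exact ⟨u, hmem u, v, hmem v, hle u v huv⟩
    · exact ⟨u, hmem u, d, by simpa using hd, hpd⟩
    · exact ⟨d, by simpa using hd, v, hmem v, hpd.symm⟩

/-- An edge `pq` may be replaced by a path through a connected set `E`. -/
theorem NonPlanar.reroute {F F' : SimpleGraph V} {E : Set V} {p q : V}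
    (h : NonPlanar (F ⊔ edge p q)) (hFE : ∀ u w, F.Adj u w → u ∉ E)
    (hle : ∀ u w, F.Adj u w → F'.Adj u w) (hE : IsConnSet F' E) (hp : p ∉ E) (hpq : p ≠ q)
    (hpE : ∃ d ∈ E, F'.Adj p d) (hqE : ∃ d ∈ E, F'.Adj q d) : NonPlanar F' := by
  obtain ⟨d, hd, hpd⟩ := hpE
  refine h.absorb (E := insert q E) (fun u w huw hu => ?_) hle (hE.insert hqE) (.inl rfl) ?_
    ⟨d, .inr hd, hpd⟩
  · exact hu.resolve_right (hFE u w huw)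
  · rintro (h | h)
    · exact hpq h
    · exact hp h

theorem nonPlanar_induce {G H : SimpleGraph V} {X : Set V} (hH : NonPlanar H)
    (h : ∀ u v, H.Adj u v → G.Adj u v ∧ u ∈ X ∧ v ∈ X) : NonPlanar (G.induce X) :=
  hH.comap Subtype.val_injective fun u v huv =>
    ⟨⟨u, (h u v huv).2.1⟩, ⟨v, (h u v huv).2.2⟩, rfl, rfl, (h u v huv).1⟩

theorem NonPlanar.of_not_isApex {G : SimpleGraph V} (h : ¬ IsApex G) (w : V) :
    NonPlanar (restrictTo G {w}ᶜ) := by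
  have : NonPlanar (G.induce {u | u ≠ w}) :=
    (not_isPlanar_iff _).1 fun hp => h (.inr ⟨w, hp⟩)
  exact this.map Subtype.val_injective fun u v huv => restrictTo_adj.2 ⟨huv, u.2, v.2⟩

theorem exists_planar_of_isApex {G H : SimpleGraph V} {X : Set V} (hG : IsApex (G.induce X))
    (hX : X.Nonempty) (hH : ∀ u v, H.Adj u v → G.Adj u v ∧ u ∈ X ∧ v ∈ X) :
    ∃ w, ¬ NonPlanar (restrictTo H {w}ᶜ) := by
  rcases hG with hp | ⟨w, hp⟩
  · obtain ⟨w, _⟩ := hX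
    refine ⟨w, fun h => (not_isPlanar_iff _).2 ?_ hp⟩
    exact nonPlanar_induce h fun u v huv => hH u v (restrictTo_adj.1 huv).1
  · refine ⟨w, fun h => (not_isPlanar_iff _).2 ?_ hp⟩
    refine h.comap (e := fun u => u.1.1)
      (Subtype.val_injective.comp Subtype.val_injective) fun u v huv => ?_
    obtain ⟨huv, hu, hv⟩ := restrictTo_adj.1 huv
    obtain ⟨h1, h2, h3⟩ := hH u v huv
    exact ⟨⟨⟨u, h2⟩, fun h => hu (congrArg Subtype.val h)⟩,
      ⟨⟨v, h3⟩, fun h => hv (congrArg Subtype.val h)⟩, rfl, rfl, h1⟩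

/-- Delete `D`, after contracting its subset `D'` into `p`. -/
def contractInto (G : SimpleGraph V) (D D' : Set V) (p : V) : SimpleGraph V where
  Adj u w := u ≠ w ∧ u ∉ D ∧ w ∉ D ∧
    (G.Adj u w ∨ (u = p ∧ ∃ d ∈ D', G.Adj d w) ∨ (w = p ∧ ∃ d ∈ D', G.Adj d u))
  symm := ⟨fun _ _ ⟨h1, h2, h3, h4⟩ => ⟨h1.symm, h3, h2, h4.imp (fun h => h.symm) Or.symm⟩⟩
  loopless := ⟨fun _ h => h.1 rfl⟩

theorem contractInto_adj {G : SimpleGraph V} {D D' : Set V} {p u w : V} :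
    (contractInto G D D' p).Adj u w ↔ u ≠ w ∧ u ∉ D ∧ w ∉ D ∧
      (G.Adj u w ∨ (u = p ∧ ∃ d ∈ D', G.Adj d w) ∨ (w = p ∧ ∃ d ∈ D', G.Adj d u)) :=
  Iff.rfl

theorem contractInto_of_adj {G : SimpleGraph V} {D D' : Set V} {p u w : V} (h : G.Adj u w)
    (hu : u ∉ D) (hw : w ∉ D) : (contractInto G D D' p).Adj u w :=
  contractInto_adj.2 ⟨h.ne, hu, hw, .inl h⟩

theorem contractInto_apex {G : SimpleGraph V} {D D' : Set V} {p w : V} (hp : p ∉ D)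
    (hw : w ∉ D) (hpw : p ≠ w) (h : ∃ d ∈ D', G.Adj d w) : (contractInto G D D' p).Adj p w :=
  contractInto_adj.2 ⟨hpw, hp, hw, .inr (.inl ⟨rfl, h⟩)⟩

theorem exists_planar_contractInto [Finite V] {G : SimpleGraph V} (hG : IsApexObstruction G)
    {D D' : Set V} {p : V} (hD : D' ⊆ D) (hne : D.Nonempty) (hp : p ∉ D)
    (hconn : IsConnSet G (insert p D')) :
    ∃ w, ¬ NonPlanar (restrictTo (contractInto G D D' p) {w}ᶜ) := by
  classical
  refine exists_planar_of_isApex (G := contractInto G D D' p) (X := Dᶜ) (hG.2 _ _ ?_ ⟨?_⟩) ⟨p, hp⟩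
    (fun u v huv => ⟨huv, (contractInto_adj.1 huv).2.1, (contractInto_adj.1 huv).2.2.1⟩)
  · rw [isMinorOf_iff]
    have hmem : ∀ u, u ∈ (if u = p then insert p D' else {u} : Set V) := by
      intro u; split_ifs with h
      · exact .inl h
      · rfl
    refine ⟨fun u => if u.1 = p then insert p D' else {u.1}, fun u => ?_, fun u v huv => ?_,
      fun u v huv => ?_⟩
    · dsimp only
      split_ifs
      · exact hconn
      · exact .singleton _ _
    · dsimp only
      have huv' : u.1 ≠ v.1 := fun h => huv (Subtype.ext h)
      have hu : u.1 ∉ D' := fun h => u.2 (hD h)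
      have hv : v.1 ∉ D' := fun h => v.2 (hD h)
      split_ifs with h1 h2 h2
      · exact (huv' (h1.trans h2.symm)).elim
      · simp [h2, hv]
      · simp [h1, hu]
      · simpa using huv'
    · obtain ⟨_, _, _, h | ⟨hu, d, hd, h⟩ | ⟨hv, d, hd, h⟩⟩ := huv
      · exact ⟨u, hmem _, v, hmem _, h⟩
      · exact ⟨d, by simp [show u.1 = p from hu, hd], v, hmem _, h⟩
      · exact ⟨u, hmem _, d, by simp [show v.1 = p from hv, hd], h.symm⟩
  · intro φ
    have h1 := Nat.card_congr φ.toEquiv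
    have h2 : Dᶜ.ncard + D.ncard = Nat.card V := by
      rw [add_comm]; exact Set.ncard_add_ncard_compl D
    have h3 : 0 < D.ncard := (Set.ncard_pos).2 hne
    rw [Nat.card_coe_set_eq] at h1
    omega

theorem exists_planar_of_lt [Finite V] [Nonempty V] {G H : SimpleGraph V}
    (hG : IsApexObstruction G) (hle : H ≤ G) {u v : V} (huv : G.Adj u v) (hH : ¬ H.Adj u v) :
    ∃ w, ¬ NonPlanar (restrictTo H {w}ᶜ) := by
  classical
  cases nonempty_fintype V
  have hapex : IsApex H := by
    refine hG.2 _ _ ?_ ⟨fun φ => ?_⟩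
    · rw [isMinorOf_iff]
      exact ⟨fun u => {u}, fun u => .singleton _ _, fun u v h => by simpa using h,
        fun u v h => ⟨u, rfl, v, rfl, hle h⟩⟩
    · have h1 := φ.card_edgeFinset_eq
      have h2 : H.edgeFinset ⊂ G.edgeFinset := by
        rw [edgeFinset_ssubset_edgeFinset]
        exact lt_of_le_of_ne hle (by rintro rfl; exact hH huv)
      exact (Finset.card_lt_card h2).ne h1
  rcases hapex with hp | ⟨w, hp⟩
  · refine ⟨Classical.arbitrary V, fun h => (not_isPlanar_iff _).2 ?_ hp⟩
    exact h.mono fun u v huv => (restrictTo_adj.1 huv).1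
  · refine ⟨w, fun h => (not_isPlanar_iff _).2 ?_ hp⟩
    exact nonPlanar_induce h fun u v huv => restrictTo_adj.1 huv

/-- A connected apex obstruction has no two disjoint nonplanar subgraphs. -/
theorem not_nonPlanar_of_disjoint [Finite V] {G : SimpleGraph V} (hG : IsApexObstruction G)
    (hconn : IsConnSet G Set.univ) {X Y : Set V} (hXY : Disjoint X Y)
    (hX : NonPlanar (restrictTo G X)) : ¬ NonPlanar (restrictTo G Y) := by
  intro hY
  obtain ⟨x, x', hx⟩ := hX.exists_adj
  obtain ⟨y, y', hy⟩ := hY.exists_adj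
  have hx := (restrictTo_adj.1 hx).2.1
  have hy := (restrictTo_adj.1 hy).2.1
  obtain ⟨u, hu, v, hv, huv⟩ : ∃ u ∈ X, ∃ v ∉ X, G.Adj u v := by
    by_contra! hcon
    have : Set.univ ⊆ X := hconn.subset_of_closed (Set.mem_univ x) hx fun u hu _ v _ huv => by
      by_contra hv
      exact hcon u hu v hv huv
    exact Set.disjoint_left.1 hXY (this (Set.mem_univ y)) hy
  have : Nonempty V := ⟨x⟩
  obtain ⟨w, hw⟩ := exists_planar_of_lt (H := restrictTo G X ⊔ restrictTo G Y) hG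
    (fun u v h => h.elim (fun h => (restrictTo_adj.1 h).1) (fun h => (restrictTo_adj.1 h).1)) huv
    (by
      rintro (h | h)
      · exact hv (restrictTo_adj.1 h).2.2
      · exact Set.disjoint_left.1 hXY hu (restrictTo_adj.1 h).2.1)
  by_cases hwX : w ∈ X
  · refine hw (hY.mono fun u v huv => restrictTo_adj.2 ⟨.inr huv, ?_, ?_⟩) <;> rintro rfl
    · exact Set.disjoint_left.1 hXY hwX (restrictTo_adj.1 huv).2.1
    · exact Set.disjoint_left.1 hXY hwX (restrictTo_adj.1 huv).2.2
  · refine hw (hX.mono fun u v huv => restrictTo_adj.2 ⟨.inl huv, ?_, ?_⟩) <;> rintro rfl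
    · exact hwX (restrictTo_adj.1 huv).2.1
    · exact hwX (restrictTo_adj.1 huv).2.2

end NonPlanar

section HeavySide

variable {V : Type}

/-- A hypothetical cut vertex `v` of the heavy side `C`, with two components `A` and `B` of
`C - v`, where `A` together with `v` becomes nonplanar when the edge `xy` is added. -/
structure CutConfig (G : SimpleGraph V) (a b : V) (C A B : Set V) (v x y : V) : Prop where
  obstruction : IsApexObstruction G
  no_cut : ∀ (T : Set V) (p q : V), T ⊆ C → T.Nonempty → p ∈ C → (q = a ∨ q ∈ C) → p ≠ q →
    p ∉ T → q ∉ T → ¬ ∀ u ∈ T, ∀ w, G.Adj u w → w ∈ T ∨ w = p ∨ w = q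
  ne : a ≠ b
  a_notMem : a ∉ C
  b_notMem : b ∉ C
  closed : ∀ u ∈ C, ∀ w, G.Adj u w → w ∈ C ∨ w = a ∨ w = b
  light : NonPlanar (restrictTo G Cᶜ ⊔ edge a b)
  heavy : NonPlanar (restrictTo G (insert a C))
  v_mem : v ∈ C
  A_sub : A ⊆ C
  v_notMem_A : v ∉ A
  A_conn : IsConnSet G A
  A_closed : ∀ u ∈ A, ∀ w ∈ C, G.Adj u w → w ∈ A ∨ w = v
  B_sub : B ⊆ C
  v_notMem_B : v ∉ B
  B_conn : IsConnSet G B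
  disj : ∀ u ∈ A, u ∉ B
  a_adj_A : ∃ u ∈ A, G.Adj a u
  v_adj_A : ∃ u ∈ A, G.Adj v u
  a_adj_B : ∃ u ∈ B, G.Adj a u
  b_adj_B : ∃ u ∈ B, G.Adj b u
  v_adj_B : ∃ u ∈ B, G.Adj v u
  x_mem : x ∈ A
  x_adj : G.Adj b x
  y_or : y = v ∨ y ∈ A ∧ G.Adj b y
  x_ne_y : x ≠ y
  bulk : NonPlanar (restrictTo G (insert v A) ⊔ edge x y)

namespace CutConfig

variable {G : SimpleGraph V} {a b : V} {C A B : Set V} {v x y : V}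

theorem swap (h : CutConfig G a b C A B v x y) (hy : y ∈ A) : CutConfig G a b C A B v y x :=
  { h with
    x_mem := hy
    x_adj := by
      rcases h.y_or with rfl | h'
      · exact (h.v_notMem_A hy).elim
      · exact h'.2
    y_or := .inr ⟨h.x_mem, h.x_adj⟩
    x_ne_y := h.x_ne_y.symm
    bulk := by rw [edge_comm]; exact h.bulk }

theorem nonPlanar_of_light (h : CutConfig G a b C A B v x y) {F : SimpleGraph V} {T : Set V}
    (hle : ∀ u w, u ∉ C → w ∉ C → G.Adj u w → F.Adj u w) (hTC : T ⊆ C) (hT : IsConnSet F T)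
    (ha : ∃ d ∈ T, F.Adj a d) (hb : ∃ d ∈ T, F.Adj b d) : NonPlanar F :=
  h.light.reroute (fun _ _ huw hu => (restrictTo_adj.1 huw).2.1 (hTC hu))
    (fun u w huw => hle u w (restrictTo_adj.1 huw).2.1 (restrictTo_adj.1 huw).2.2
      (restrictTo_adj.1 huw).1) hT (fun ha => h.a_notMem (hTC ha)) h.ne ha hb

theorem planar_A [Finite V] (h : CutConfig G a b C A B v x y) :
    ¬ NonPlanar (restrictTo G {u | u ∈ A ∨ u = v ∨ u = a} ⊔ edge v a) := by
  intro hNP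
  have hAC := h.A_sub
  have hBC := h.B_sub
  have hvC := h.v_mem
  have haC := h.a_notMem
  have hbC := h.b_notMem
  have hvB := h.v_notMem_B
  have hab := h.ne
  obtain ⟨w, hw⟩ := exists_planar_contractInto h.obstruction
    (D := {u | u ∈ C ∧ u ∉ A ∧ u ≠ v}) (D' := B) (p := v)
    (fun u hu => ⟨hBC hu, fun hA => h.disj u hA hu, fun e => hvB (e ▸ hu)⟩)
    (by
      obtain ⟨u, hu⟩ := h.B_conn.1
      exact ⟨u, hBC hu, fun hA => h.disj u hA hu, fun e => hvB (e ▸ hu)⟩)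
    (fun hv => hv.2.2 rfl) (h.B_conn.insert h.v_adj_B)
  apply hw
  have hG : ∀ s t, G.Adj s t → (s ∈ A ∨ s = v ∨ s ∉ C) → (t ∈ A ∨ t = v ∨ t ∉ C) → s ≠ w →
      t ≠ w → (restrictTo (contractInto G {u | u ∈ C ∧ u ∉ A ∧ u ≠ v} B v) {w}ᶜ).Adj s t := by
    intro s t hst hs ht hsw htw
    refine restrictTo_adj.2 ⟨contractInto_of_adj hst ?_ ?_, hsw, htw⟩ <;>
    · simp only [Set.mem_ofPred_eq]; tauto
  have hv : ∀ t, t ∉ C → (∃ u ∈ B, G.Adj t u) → v ≠ w → t ≠ w →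
      (restrictTo (contractInto G {u | u ∈ C ∧ u ∉ A ∧ u ≠ v} B v) {w}ᶜ).Adj v t := by
    rintro t ht ⟨u, hu, htu⟩ hvw htw
    refine restrictTo_adj.2 ⟨contractInto_apex (fun hv => hv.2.2 rfl) (fun h => ht h.1) ?_
      ⟨u, hu, htu.symm⟩, hvw, htw⟩
    rintro rfl
    exact ht hvC
  by_cases hwb : w = b
  · subst hwb
    refine hNP.mono fun s t hst => ?_
    rw [sup_adj, edge_adj, restrictTo_adj] at hst
    rcases hst with ⟨hst, hs, ht⟩ | ⟨⟨rfl, rfl⟩ | ⟨rfl, rfl⟩, _⟩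
    · simp only [Set.mem_ofPred_eq] at hs ht
      exact hG s t hst (by grind) (by grind) (by grind) (by grind)
    · exact hv _ haC h.a_adj_B (by grind) hab
    · exact (hv _ haC h.a_adj_B (by grind) hab).symm
  by_cases hwC : w ∈ C
  · by_cases hwv : w = v
    · have hne : ∀ s ∈ A, s ≠ w := fun s hs e => h.v_notMem_A (hwv ▸ e ▸ hs)
      obtain ⟨z, hz, haz⟩ := h.a_adj_A
      exact h.nonPlanar_of_light (T := A) (fun s t hs ht hst => hG s t hst (.inr (.inr hs))
        (.inr (.inr ht)) (by grind) (by grind)) hAC (h.A_conn.mono fun s hs t ht hst =>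
          hG s t hst (.inl hs) (.inl ht) (hne s hs) (hne t ht))
        ⟨z, hz, hG _ _ haz (.inr (.inr haC)) (.inl hz) (by grind) (hne z hz)⟩
        ⟨x, h.x_mem, hG _ _ h.x_adj (.inr (.inr hbC)) (.inl h.x_mem) (by grind) (hne x h.x_mem)⟩
    · exact h.nonPlanar_of_light (T := {v}) (fun s t hs ht hst => hG s t hst (.inr (.inr hs))
        (.inr (.inr ht)) (by grind) (by grind)) (by simpa using hvC) (.singleton _ _)
        ⟨v, rfl, (hv a haC h.a_adj_B (Ne.symm hwv) (by grind)).symm⟩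
        ⟨v, rfl, (hv b hbC h.b_adj_B (Ne.symm hwv) (by grind)).symm⟩
  · refine h.bulk.reroute (E := {b}) (fun s t hst hs => ?_) (fun s t hst => ?_) (.singleton _ _)
      (by have := h.x_mem; grind) h.x_ne_y ⟨b, rfl, ?_⟩ ⟨b, rfl, ?_⟩
    · rw [Set.mem_singleton_iff] at hs
      subst hs
      rcases (restrictTo_adj.1 hst).2.1 with rfl | hs
      · exact hbC hvC
      · exact hbC (hAC hs)
    · obtain ⟨hst, hs, ht⟩ := restrictTo_adj.1 hst
      rw [Set.mem_insert_iff] at hs ht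
      exact hG s t hst (by tauto) (by tauto) (by grind) (by grind)
    · have hxA := h.x_mem
      exact hG _ _ h.x_adj.symm (.inl hxA) (.inr (.inr hbC)) (by grind) (by grind)
    · rcases h.y_or with rfl | ⟨hyA, hyb⟩
      · exact hv b hbC h.b_adj_B (by grind) (by grind)
      · exact hG _ _ hyb.symm (.inl hyA) (.inr (.inr hbC)) (by grind) (by grind)

theorem nonPlanar_compl (h : CutConfig G a b C A B v x y) [Finite V] :
    NonPlanar (restrictTo G {u | (u ∈ C ∧ u ∉ A) ∨ u = a} ⊔ edge v a) := by
  have hvC := h.v_mem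
  have haC := h.a_notMem
  have hbC := h.b_notMem
  have hAC := h.A_sub
  rcases h.heavy.split {u | u ∈ A ∨ u = v ∨ u = a} Aᶜ v a (by grind) (by grind) (by
    intro s t hs ht hst
    obtain ⟨hst, hs', ht'⟩ := restrictTo_adj.1 hst
    have := h.A_closed s (by simpa using hs) t
    have := h.closed s (hAC (by simpa using hs)) t hst
    grind) with h1 | h1
  · refine (h.planar_A (h1.mono fun s t hst => ?_)).elim
    refine hst.imp (fun hst => ?_) id
    obtain ⟨hst, hs, ht⟩ := restrictTo_adj.1 hst
    exact restrictTo_adj.2 ⟨(restrictTo_adj.1 hst).1, hs, ht⟩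
  · refine h1.mono fun s t hst => hst.imp (fun hst => ?_) id
    obtain ⟨hst, hs, ht⟩ := restrictTo_adj.1 hst
    obtain ⟨hst, hs', ht'⟩ := restrictTo_adj.1 hst
    exact restrictTo_adj.2 ⟨hst, by grind, by grind⟩

/-- No connected subset of `A - x` is adjacent to both `a` and `v`. -/
theorem no_bypass [Finite V] (h : CutConfig G a b C A B v x y) {T : Set V} (hT : IsConnSet G T)
    (hTA : T ⊆ A) (hxT : x ∉ T) (ha : ∃ d ∈ T, G.Adj a d) (hv : ∃ d ∈ T, G.Adj v d) : False := by
  classical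
  have hAC := h.A_sub
  have hBC := h.B_sub
  have hvC := h.v_mem
  have haC := h.a_notMem
  have hbC := h.b_notMem
  have hvA := h.v_notMem_A
  have hvB := h.v_notMem_B
  have hxA := h.x_mem
  have hab := h.ne
  have hdisj := h.disj
  obtain ⟨w, hw⟩ := exists_planar_contractInto h.obstruction (D := {x}) (D' := {x}) (p := b)
    subset_rfl ⟨x, rfl⟩ (by grind) ((IsConnSet.singleton G x).insert ⟨x, rfl, h.x_adj⟩)
  apply hw
  set K := restrictTo (contractInto G {x} {x} b) {w}ᶜ with hK
  have hG : ∀ s t, G.Adj s t → s ≠ x → t ≠ x → s ≠ w → t ≠ w → K.Adj s t :=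
    fun s t hst hs ht hsw htw => restrictTo_adj.2 ⟨contractInto_of_adj hst hs ht, hsw, htw⟩
  have hb : ∀ t, G.Adj x t → t ≠ b → b ≠ w → t ≠ w → K.Adj b t :=
    fun t hxt htb hbw htw => restrictTo_adj.2 ⟨contractInto_apex (by grind)
      (fun e => hxt.ne e.symm) htb.symm ⟨x, rfl, hxt⟩, hbw, htw⟩
  by_cases hwb : w = b
  · subst hwb
    obtain ⟨d, hd, had⟩ := ha
    obtain ⟨e, he, hve⟩ := hv
    refine h.nonPlanar_compl.reroute (E := T) (fun s t hst hs => ?_) (fun s t hst => ?_)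
      (hT.mono fun s hs t ht hst => hG s t hst (by grind) (by grind) (by grind) (by grind))
      (by grind) (by grind) ⟨e, he, hG _ _ hve (by grind) (by grind) (by grind) (by grind)⟩
      ⟨d, hd, hG _ _ had (by grind) (by grind) (by grind) (by grind)⟩
    · have := (restrictTo_adj.1 hst).2.1
      grind
    · obtain ⟨hst, hs, ht⟩ := restrictTo_adj.1 hst
      exact hG s t hst (by grind) (by grind) (by grind) (by grind)
  by_cases hwC : w ∈ C
  · by_cases hwB : w ∈ B
    · have hcl : IsConnSet K (insert b (A \ {x})) := by
        refine ⟨⟨b, .inl rfl⟩, fun T' hT' hne hcl => ?_⟩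
        have hbT : b ∈ T' := by
          by_contra hbT
          obtain ⟨t, ht⟩ := hne
          have := h.A_conn.subset_of_closed (T := T') (t := t) (by grind) ht
            fun u hu huA z hz huz => by
              by_cases hzx : z = x
              · subst hzx
                exact (hbT (hcl u hu b (.inl rfl)
                  (hb u huz.symm (by grind) (Ne.symm hwb) (by grind)).symm)).elim
              · exact hcl u hu z (.inr ⟨hz, hzx⟩)
                  (hG _ _ huz (by grind) hzx (by grind) (by grind))
          grind
        have := h.A_conn.subset_of_closed (T := insert x T') hxA (.inl rfl)
          fun u hu huA z hz huz => by
            by_cases hzx : z = x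
            · exact .inl hzx
            refine .inr ?_
            by_cases hux : u = x
            · subst hux
              exact hcl b hbT z (.inr ⟨hz, hzx⟩)
                (hb z huz (by grind) (Ne.symm hwb) (by grind))
            · exact hcl u (by grind) z (.inr ⟨hz, hzx⟩)
                (hG _ _ huz hux hzx (by grind) (by grind))
        grind
      refine h.light.absorb (F' := K) (E := insert b (A \ {x})) (fun s t hst hs => ?_)
        (fun s t hst => ?_) hcl (.inl rfl) (by grind) ?_
      · have := (restrictTo_adj.1 hst).2.1
        grind
      · obtain ⟨hst, hs, ht⟩ := restrictTo_adj.1 hst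
        exact hG s t hst (by grind) (by grind) (by grind) (by grind)
      · obtain ⟨z, hz, haz⟩ := h.a_adj_A
        by_cases hzx : z = x
        · exact ⟨b, .inl rfl, (hb a (hzx ▸ haz.symm) hab (Ne.symm hwb) (by grind)).symm⟩
        · exact ⟨z, .inr ⟨hz, hzx⟩, hG _ _ haz (by grind) (by grind) (by grind) (by grind)⟩
    · obtain ⟨d, hd, had⟩ := h.a_adj_B
      obtain ⟨e, he, hbe⟩ := h.b_adj_B
      exact h.nonPlanar_of_light (T := B)
        (fun s t hs ht hst => hG s t hst (by grind) (by grind) (by grind) (by grind)) hBC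
        (h.B_conn.mono fun s hs t ht hst =>
          hG s t hst (by grind) (by grind) (by grind) (by grind))
        ⟨d, hd, hG _ _ had (by grind) (by grind) (by grind) (by grind)⟩
        ⟨e, he, hG _ _ hbe (by grind) (by grind) (by grind) (by grind)⟩
  · have hyw : y ∈ insert v A := h.y_or.imp id And.left
    have hyx := h.x_ne_y
    have hmem : ∀ u, u ≠ x → u ∈ (if u = x then insert b B else {u} : Set V) := by
      intro u hu
      simp [hu]
    have hxe : ∀ t, t ∈ insert v A → G.Adj x t → K.Adj b t :=
      fun t ht hxt => hb t hxt (by grind) (Ne.symm hwb) (by grind)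
    have hxy : ∃ s ∈ insert b B, K.Adj s y := by
      rcases h.y_or with rfl | ⟨hyA, hby⟩
      · obtain ⟨d, hd, hvd⟩ := h.v_adj_B
        exact ⟨d, .inr hd, hG _ _ hvd.symm (by grind) (by grind) (by grind) (by grind)⟩
      · exact ⟨b, .inl rfl, hG _ _ hby (by grind) (by grind) (by grind) (by grind)⟩
    refine h.bulk.trans (insert v A) (fun s t hst => ?_)
      (fun u => if u = x then insert b B else {u}) (fun u hu => ?_) (fun s hs t ht hst => ?_)
      (fun s t hst => ?_)
    · rw [sup_adj, edge_adj, restrictTo_adj] at hst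
      grind
    · split_ifs
      · obtain ⟨e, he, hbe⟩ := h.b_adj_B
        exact IsConnSet.insert (h.B_conn.mono fun s hs t ht hst =>
          hG s t hst (by grind) (by grind) (by grind) (by grind))
          ⟨e, he, hG _ _ hbe (by grind) (by grind) (by grind) (by grind)⟩
      · exact .singleton _ _
    · rw [Set.disjoint_left]
      split_ifs <;> grind
    · rw [sup_adj, edge_adj, restrictTo_adj] at hst
      rcases hst with ⟨hst, hs, ht⟩ | ⟨⟨rfl, rfl⟩ | ⟨rfl, rfl⟩, _⟩
      · by_cases hsx : s = x
        · subst hsx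
          exact ⟨b, by simp, t, hmem t hst.ne', hxe t ht hst⟩
        by_cases htx : t = x
        · subst htx
          exact ⟨s, hmem s hst.ne, b, by simp, (hxe s hs hst.symm).symm⟩
        · exact ⟨s, hmem s hsx, t, hmem t htx,
            hG s t hst hsx htx (by grind) (by grind)⟩
      · obtain ⟨d, hd, hdy⟩ := hxy
        exact ⟨d, by simpa using hd, _, hmem _ hyx.symm, hdy⟩
      · obtain ⟨d, hd, hdy⟩ := hxy
        exact ⟨_, hmem _ hyx.symm, d, by simpa using hd, hdy.symm⟩

theorem b_adj_A [Finite V] (h : CutConfig G a b C A B v x y) {u : V} (hu : u ∈ A)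
    (hbu : G.Adj b u) : u = x ∨ u = y := by
  by_contra! hne
  obtain ⟨hux, huy⟩ := hne
  have hAC := h.A_sub
  have hBC := h.B_sub
  have hvC := h.v_mem
  have haC := h.a_notMem
  have hbC := h.b_notMem
  have hvA := h.v_notMem_A
  have hvB := h.v_notMem_B
  have hxA := h.x_mem
  have hab := h.ne
  have hdisj := h.disj
  have : Nonempty V := ⟨b⟩
  have hbu' : b ≠ u := hbu.ne
  obtain ⟨w, hw⟩ := exists_planar_of_lt h.obstruction (H := G.deleteEdges {s(b, u)})
    (deleteEdges_le _) hbu (by simp)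
  apply hw
  set K := restrictTo (G.deleteEdges {s(b, u)}) {w}ᶜ with hK
  have hG : ∀ s t, G.Adj s t → (s ≠ b ∨ t ≠ u) → (s ≠ u ∨ t ≠ b) → s ≠ w → t ≠ w →
      K.Adj s t := by
    intro s t hst h1 h2 hsw htw
    refine restrictTo_adj.2 ⟨?_, hsw, htw⟩
    rw [deleteEdges_adj, Set.mem_singleton_iff, Sym2.eq_iff]
    grind
  by_cases hwb : w = b
  · subst hwb
    refine (NonPlanar.of_not_isApex h.obstruction.1 w).mono fun s t hst => ?_
    obtain ⟨hst, hs, ht⟩ := restrictTo_adj.1 hst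
    exact hG s t hst (.inl hs) (.inr ht) hs ht
  by_cases hwC : w ∈ C
  · by_cases hwB : w ∈ B
    · obtain ⟨d, hd, had⟩ := h.a_adj_A
      exact h.nonPlanar_of_light (T := A)
        (fun s t hs ht hst => hG s t hst (by grind) (by grind) (by grind) (by grind)) hAC
        (h.A_conn.mono fun s hs t ht hst =>
          hG s t hst (by grind) (by grind) (by grind) (by grind))
        ⟨d, hd, hG _ _ had (by grind) (by grind) (by grind) (by grind)⟩
        ⟨x, hxA, hG _ _ h.x_adj (by grind) (by grind) (by grind) (by grind)⟩
    · obtain ⟨d, hd, had⟩ := h.a_adj_B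
      obtain ⟨e, he, hbe⟩ := h.b_adj_B
      exact h.nonPlanar_of_light (T := B)
        (fun s t hs ht hst => hG s t hst (by grind) (by grind) (by grind) (by grind)) hBC
        (h.B_conn.mono fun s hs t ht hst =>
          hG s t hst (by grind) (by grind) (by grind) (by grind))
        ⟨d, hd, hG _ _ had (by grind) (by grind) (by grind) (by grind)⟩
        ⟨e, he, hG _ _ hbe (by grind) (by grind) (by grind) (by grind)⟩
  · have hyw : y ∈ insert v A := h.y_or.imp id And.left
    obtain ⟨e, he, hbe⟩ := h.b_adj_B
    refine h.bulk.reroute (E := insert b B) (fun s t hst hs => ?_) (fun s t hst => ?_)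
      (IsConnSet.insert (h.B_conn.mono fun s hs t ht hst =>
          hG s t hst (by grind) (by grind) (by grind) (by grind))
          ⟨e, he, hG _ _ hbe (by grind) (by grind) (by grind) (by grind)⟩) (by grind) h.x_ne_y
      ⟨b, .inl rfl, hG _ _ h.x_adj.symm (by grind) (by grind) (by grind) (by grind)⟩ ?_
    · have := (restrictTo_adj.1 hst).2.1
      grind
    · obtain ⟨hst, hs, ht⟩ := restrictTo_adj.1 hst
      exact hG s t hst (by grind) (by grind) (by grind) (by grind)
    · rcases h.y_or with rfl | ⟨hyA, hby⟩
      · obtain ⟨d, hd, hvd⟩ := h.v_adj_B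
        exact ⟨d, .inr hd, hG _ _ hvd (by grind) (by grind) (by grind) (by grind)⟩
      · exact ⟨b, .inl rfl, hG _ _ hby.symm (by grind) (by grind) (by grind) (by grind)⟩

theorem exists_mem_ne [Finite V] (h : CutConfig G a b C A B v x y) :
    ∃ t ∈ A, t ≠ x ∧ t ≠ y := by
  by_contra! hno
  have h5 := h.bulk.five_le (X := {x, y, v}) (Set.toFinite _) fun s t hst => by
    rw [sup_adj, edge_adj, restrictTo_adj] at hst
    have := hno s
    have := h.v_notMem_A
    grind
  have h3 : ({x, y, v} : Set V).ncard ≤ 3 := by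
    refine (Set.ncard_insert_le _ _).trans ?_
    have := Set.ncard_insert_le y {v}
    rw [Set.ncard_singleton] at this
    omega
  omega

/-- Every component of `A - x` contains `y`, so `A - x` is connected. -/
theorem conn_diff [Finite V] (h : CutConfig G a b C A B v x y) :
    y ∈ A ∧ IsConnSet G (A \ {x}) := by
  have hAC := h.A_sub
  have hvC := h.v_mem
  have haC := h.a_notMem
  have hvA := h.v_notMem_A
  have hxA := h.x_mem
  have hbC := h.b_notMem
  have key : ∀ t ∈ A, t ≠ x → ∀ D, D ⊆ A \ {x} → t ∈ D → IsConnSet G D →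
      (∀ u ∈ D, ∀ z ∈ A \ {x}, G.Adj u z → z ∈ D) → y ∈ D := by
    intro t ht htx D hD htD hconn hcl
    by_contra hyD
    have hN : ∀ u ∈ D, ∀ w, G.Adj u w → w ∈ D ∨ w = x ∨ w = v ∨ w = a := by
      intro u hu w huw
      have huA := (hD hu).1
      by_cases hwb : w = b
      · subst hwb
        have hux : u ≠ x := (hD hu).2
        have := h.b_adj_A huA huw.symm
        grind
      have := h.closed u (hAC huA) w huw
      have := h.A_closed u huA w
      have := hcl u hu w
      grind
    by_cases hvD : ∃ d ∈ D, G.Adj v d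
    · by_cases haD : ∃ d ∈ D, G.Adj a d
      · exact h.no_bypass hconn (hD.trans Set.sdiff_subset) (fun hx => (hD hx).2 rfl) haD hvD
      · refine h.no_cut D x v (by grind) ⟨t, htD⟩ (hAC hxA) (.inr hvC) (by grind) (by grind)
          (by grind) fun u hu w huw => ?_
        rcases hN u hu w huw with h1 | h1 | h1 | rfl
        · exact .inl h1
        · exact .inr (.inl h1)
        · exact .inr (.inr h1)
        · exact (haD ⟨u, hu, huw.symm⟩).elim
    · refine h.no_cut D x a (by grind) ⟨t, htD⟩ (hAC hxA) (.inl rfl) (by grind) (by grind)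
        (by grind) fun u hu w huw => ?_
      rcases hN u hu w huw with h1 | h1 | rfl | h1
      · exact .inl h1
      · exact .inr (.inl h1)
      · exact (hvD ⟨u, hu, huw.symm⟩).elim
      · exact .inr (.inr h1)
  obtain ⟨t, htA, htx, hty⟩ := h.exists_mem_ne
  obtain ⟨D, hD, htD, hconn, hcl⟩ := exists_component G (X := A \ {x}) (p := t) ⟨htA, htx⟩
  have hyD := key t htA htx D hD htD hconn hcl
  refine ⟨(hD hyD).1, ?_⟩
  suffices A \ {x} ⊆ D by rwa [this.antisymm hD]
  intro s hs
  obtain ⟨D', hD', hsD', hconn', hcl'⟩ := exists_component G hs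
  have hyD' := key s hs.1 hs.2 D' hD' hsD' hconn' hcl'
  exact hconn'.subset_of_closed hyD' hyD
    (fun u hu _ z hz huz => hcl u hu z (hD' hz) huz) hsD'

theorem false [Finite V] (h : CutConfig G a b C A B v x y) : False := by
  obtain ⟨hyA, hcx⟩ := h.conn_diff
  have h' := h.swap hyA
  obtain ⟨-, hcy⟩ := h'.conn_diff
  have hx := h.no_bypass hcx Set.sdiff_subset (by simp)
  have hy := h'.no_bypass hcy Set.sdiff_subset (by simp)
  have hxA := h.x_mem
  have hxy := h.x_ne_y
  have hAC := h.A_sub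
  obtain ⟨t, htA, htx, hty⟩ := h.exists_mem_ne
  obtain ⟨p, hpA, hap⟩ := h.a_adj_A
  obtain ⟨q, hqA, hvq⟩ := h.v_adj_A
  refine h.no_cut (A \ {x, y}) x y (by grind) ⟨t, by grind⟩ (hAC hxA) (.inr (hAC hyA)) hxy
    (by grind) (by grind) fun u hu w huw => ?_
  have huA := hu.1
  have hux : u ≠ x := by grind
  have huy : u ≠ y := by grind
  by_contra! hno
  have := h.closed u (hAC huA) w huw
  have := h.A_closed u huA w
  have : w ≠ b := by
    rintro rfl
    have := h.b_adj_A huA huw.symm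
    tauto
  have hw : w = a ∨ w = v := by grind
  rcases hw with rfl | rfl
  · by_cases hqx : q = x
    · exact hy ⟨u, ⟨huA, huy⟩, huw.symm⟩ ⟨q, ⟨hqA, by grind⟩, hvq⟩
    · exact hx ⟨u, ⟨huA, hux⟩, huw.symm⟩ ⟨q, ⟨hqA, hqx⟩, hvq⟩
  · by_cases hpx : p = x
    · exact hy ⟨p, ⟨hpA, by grind⟩, hap⟩ ⟨u, ⟨huA, huy⟩, huw.symm⟩
    · exact hx ⟨p, ⟨hpA, hpx⟩, hap⟩ ⟨u, ⟨huA, hux⟩, huw.symm⟩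

end CutConfig

/-- The standing assumptions on the heavy side `C` of the unique 2-cut `{a, b}`, with `L` another
side of that cut. -/
structure HeavySetting (G : SimpleGraph V) (a b : V) (C L : Set V) : Prop where
  obstruction : IsApexObstruction G
  conn : IsConnSet G Set.univ
  conn_compl : ∀ v, IsConnSet G {v}ᶜ
  cut : ∀ (T : Set V) (p q l : V), T.Nonempty → p ≠ q → p ∉ T → q ∉ T → l ∉ T → l ≠ p → l ≠ q →
    (∀ u ∈ T, ∀ w, G.Adj u w → w ∈ T ∨ w = p ∨ w = q) → ({p, q} : Set V) = {a, b}
  ne : a ≠ b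
  a_notMem : a ∉ C
  b_notMem : b ∉ C
  closed : ∀ u ∈ C, ∀ w, G.Adj u w → w ∈ C ∨ w = a ∨ w = b
  C_conn : IsConnSet G C
  L_conn : IsConnSet G L
  L_closed : ∀ u ∈ L, ∀ w, G.Adj u w → w ∈ L ∨ w = a ∨ w = b
  L_notMem : ∀ u ∈ L, u ∉ C ∧ u ≠ a ∧ u ≠ b
  heavy_a : NonPlanar (restrictTo G (insert a C))
  heavy_b : NonPlanar (restrictTo G (insert b C))
  planar : ¬ NonPlanar (restrictTo G C)

namespace HeavySetting

variable {G : SimpleGraph V} {a b : V} {C L : Set V}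

theorem adj_L (h : HeavySetting G a b C L) :
    (∃ u ∈ L, G.Adj a u) ∧ ∃ u ∈ L, G.Adj b u := by
  obtain ⟨l, hl⟩ := h.L_conn.1
  have hL := h.L_notMem
  have hab := h.ne
  constructor
  · by_contra! hno
    have := (h.conn_compl b).subset_of_closed (T := L) (hL l hl).2.2 hl fun u hu _ w hw huw => by
      have := h.L_closed u hu w huw
      have := hno u hu
      have := huw.symm
      grind
    exact (hL a (this hab)).2.1 rfl
  · by_contra! hno
    have := (h.conn_compl a).subset_of_closed (T := L) (hL l hl).2.1 hl fun u hu _ w hw huw => by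
      have := h.L_closed u hu w huw
      have := hno u hu
      have := huw.symm
      grind
    exact (hL b (this hab.symm)).2.2 rfl

theorem light [Finite V] (h : HeavySetting G a b C L) :
    NonPlanar (restrictTo G Cᶜ ⊔ edge a b) := by
  have hab := h.ne
  have haC := h.a_notMem
  have hbC := h.b_notMem
  obtain ⟨haL, d, hd, hbd⟩ := h.adj_L
  obtain ⟨w, hw⟩ := exists_planar_contractInto h.obstruction
    (D := {u | u ∉ C ∧ u ≠ a ∧ u ≠ b}) (D' := L) (p := a) h.L_notMem ⟨d, h.L_notMem d hd⟩
    (by simp) (h.L_conn.insert haL)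
  set K := restrictTo (contractInto G {u | u ∉ C ∧ u ≠ a ∧ u ≠ b} L a) {w}ᶜ with hK
  have hG : ∀ s t, G.Adj s t → (s ∈ C ∨ s = a ∨ s = b) → (t ∈ C ∨ t = a ∨ t = b) → s ≠ w →
      t ≠ w → K.Adj s t := fun s t hst hs ht hsw htw =>
    restrictTo_adj.2 ⟨contractInto_of_adj hst (by grind) (by grind), hsw, htw⟩
  by_cases hwa : w = a
  · subst hwa
    refine (hw (h.heavy_b.mono fun s t hst => ?_)).elim
    obtain ⟨hst, hs, ht⟩ := restrictTo_adj.1 hst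
    exact hG s t hst (by grind) (by grind) (by grind) (by grind)
  by_cases hwC : w ∈ C
  · rcases (NonPlanar.of_not_isApex h.obstruction.1 w).split {u | u ∈ C ∨ u = a ∨ u = b} Cᶜ a b
      (by grind) (by grind) (fun s t hs ht hst => by
        have := h.closed s (by grind) t (restrictTo_adj.1 hst).1
        grind) with h1 | h1
    · refine (hw (h1.mono fun s t hst => ?_)).elim
      have hab' : K.Adj a b := restrictTo_adj.2 ⟨contractInto_apex (by simp) (by simp) hab
        ⟨d, hd, hbd.symm⟩, Ne.symm hwa, by grind⟩
      rw [sup_adj, edge_adj, restrictTo_adj, restrictTo_adj] at hst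
      rcases hst with ⟨⟨hst, hs, ht⟩, hs', ht'⟩ | ⟨⟨rfl, rfl⟩ | ⟨rfl, rfl⟩, _⟩
      · exact hG s t hst hs' ht' hs ht
      · exact hab'
      · exact hab'.symm
    · refine h1.mono fun s t hst => hst.imp (fun hst => ?_) id
      obtain ⟨hst, hs, ht⟩ := restrictTo_adj.1 hst
      exact restrictTo_adj.2 ⟨(restrictTo_adj.1 hst).1, hs, ht⟩
  · refine (hw (h.heavy_a.mono fun s t hst => ?_)).elim
    obtain ⟨hst, hs, ht⟩ := restrictTo_adj.1 hst
    exact hG s t hst (by grind) (by grind) (by grind) (by grind)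

/-- A nonplanar subgraph avoiding `a` in which `b` has degree at most two yields a nonplanar graph
obtained from the heavy side by adding a single edge between neighbours of `b`. -/
theorem exists_edge [Finite V] (h : HeavySetting G a b C L) {F : SimpleGraph V} (hF : NonPlanar F)
    (hle : ∀ u w, F.Adj u w → G.Adj u w ∧ u ≠ a ∧ w ≠ a) (hdeg : {w | F.Adj b w}.ncard < 3) :
    ∃ x ∈ C, ∃ y ∈ C, x ≠ y ∧ G.Adj b x ∧ G.Adj b y ∧ NonPlanar (restrictTo G C ⊔ edge x y) := by
  have hbC := h.b_notMem
  have haC := h.a_notMem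
  obtain ⟨x, y, hxy, hor⟩ : ∃ x y, (∀ w ∈ C, F.Adj b w → w = x ∨ w = y) ∧
      (x = y ∨ (x ∈ C ∧ F.Adj b x) ∧ y ∈ C ∧ F.Adj b y) := by
    have hN : {w | w ∈ C ∧ F.Adj b w}.ncard < 3 :=
      (Set.ncard_le_ncard (fun w hw => hw.2) (Set.toFinite _)).trans_lt hdeg
    have : Nonempty V := ⟨a⟩
    by_cases h1 : {w | w ∈ C ∧ F.Adj b w}.ncard ≤ 1
    · obtain ⟨x, hx⟩ := (Set.ncard_le_one_iff_subset_singleton (Set.toFinite _)).1 h1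
      exact ⟨x, x, fun w hw hbw => .inl (hx ⟨hw, hbw⟩), .inl rfl⟩
    · obtain ⟨x, y, hne, hx⟩ := Set.ncard_eq_two.1
        (show {w | w ∈ C ∧ F.Adj b w}.ncard = 2 by omega)
      refine ⟨x, y, fun w hw hbw => ?_, .inr ⟨?_, ?_⟩⟩
      · have : w ∈ ({x, y} : Set V) := hx ▸ ⟨hw, hbw⟩
        simpa using this
      · have : x ∈ ({x, y} : Set V) := by simp
        rwa [← hx] at this
      · have : y ∈ ({x, y} : Set V) := by simp
        rwa [← hx] at this
  have hNP : NonPlanar (restrictTo G C ⊔ edge x y) := by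
    rcases hF.split (insert b C) Cᶜ b b (by grind) (by grind) (fun s t hs ht hst => by
      have := h.closed s (by grind) t (hle s t hst).1
      have := hle s t hst
      grind) with h1 | h1
    · refine (h1.suppress (b := b) (x := x) (y := y) fun u hu => ?_).mono fun s t hst =>
        hst.imp (fun hst => ?_) id
      · rw [sup_adj, edge_adj, restrictTo_adj] at hu
        have : ¬ F.Adj b b := F.irrefl
        refine hxy u ?_ ?_ <;> grind
      · rw [restrictTo_adj, sup_adj, edge_adj, restrictTo_adj] at hst
        refine restrictTo_adj.2 ⟨(hle s t ?_).1, ?_, ?_⟩ <;> grind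
    · refine (not_nonPlanar_of_disjoint h.obstruction h.conn (X := insert a C)
        (Y := {u | u ∉ C ∧ u ≠ a}) (Set.disjoint_left.2 (by grind)) h.heavy_a
        (h1.mono fun s t hst => ?_)).elim
      rw [sup_adj, edge_adj, restrictTo_adj] at hst
      have hst' : F.Adj s t := by grind
      have := hle s t hst'
      exact restrictTo_adj.2 ⟨this.1, by grind, by grind⟩
  rcases hor with rfl | ⟨⟨hxC, hbx⟩, hyC, hby⟩
  · refine (h.planar (hNP.mono fun s t hst => ?_)).elim
    rw [sup_adj, edge_adj] at hst
    grind
  · by_cases hne : x = y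
    · subst hne
      refine (h.planar (hNP.mono fun s t hst => ?_)).elim
      rw [sup_adj, edge_adj] at hst
      grind
    · exact ⟨x, hxC, y, hyC, hne, (hle _ _ hbx).1, (hle _ _ hby).1, hNP⟩

/-- Every component of `C - v` has neighbours `v`, `a` and `b`. -/
theorem adj_component (h : HeavySetting G a b C L) {A : Set V} {v : V} (hv : v ∈ C)
    (hA : A ⊆ C \ {v}) (hne : A.Nonempty)
    (hcl : ∀ u ∈ A, ∀ w ∈ C \ {v}, G.Adj u w → w ∈ A) :
    (∃ u ∈ A, G.Adj v u) ∧ (∃ u ∈ A, G.Adj a u) ∧ ∃ u ∈ A, G.Adj b u := by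
  have haC := h.a_notMem
  have hbC := h.b_notMem
  have hab := h.ne
  obtain ⟨t, ht⟩ := hne
  have hva : ({v, a} : Set V) ≠ {a, b} := fun e => by
    have : v ∈ ({a, b} : Set V) := e ▸ .inl rfl
    grind
  have hvb : ({v, b} : Set V) ≠ {a, b} := fun e => by
    have : v ∈ ({a, b} : Set V) := e ▸ .inl rfl
    grind
  refine ⟨?_, ?_, ?_⟩ <;> by_contra! hno
  · have := h.C_conn.subset_of_closed (T := A) (hA ht).1 ht fun u hu _ w hw huw => by
      refine hcl u hu w ⟨hw, ?_⟩ huw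
      rintro rfl
      exact hno u hu huw.symm
    exact (hA (this hv)).2 rfl
  · refine hvb (h.cut A v b a ⟨t, ht⟩ (by grind) (by grind) (by grind) (by grind) (by grind) hab
      fun u hu w huw => ?_)
    have := h.closed u (hA hu).1 w huw
    have := hcl u hu w
    have : w ≠ a := by
      rintro rfl
      exact hno u hu huw.symm
    grind
  · refine hva (h.cut A v a b ⟨t, ht⟩ (by grind) (by grind) (by grind) (by grind) (by grind)
      hab.symm fun u hu w huw => ?_)
    have := h.closed u (hA hu).1 w huw
    have := hcl u hu w
    have : w ≠ b := by
      rintro rfl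
      exact hno u hu huw.symm
    grind

theorem false_of_bulk [Finite V] (h : HeavySetting G a b C L) {A B : Set V} {v x y : V}
    (hv : v ∈ C) (hA : A ⊆ C \ {v}) (hAc : IsConnSet G A)
    (hAcl : ∀ u ∈ A, ∀ w ∈ C \ {v}, G.Adj u w → w ∈ A) (hB : B ⊆ C \ {v}) (hBc : IsConnSet G B)
    (hBcl : ∀ u ∈ B, ∀ w ∈ C \ {v}, G.Adj u w → w ∈ B) (hdisj : ∀ u ∈ A, u ∉ B) (hx : x ∈ A)
    (hbx : G.Adj b x) (hy : y = v ∨ y ∈ A ∧ G.Adj b y) (hxy : x ≠ y)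
    (hbulk : NonPlanar (restrictTo G (insert v A) ⊔ edge x y)) : False := by
  obtain ⟨hvA, haA, -⟩ := h.adj_component hv hA hAc.1 hAcl
  obtain ⟨hvB, haB, hbB⟩ := h.adj_component hv hB hBc.1 hBcl
  have haC := h.a_notMem
  have hbC := h.b_notMem
  refine CutConfig.false (G := G) (a := a) (b := b) (C := C) (A := A) (B := B) (v := v) (x := x)
    (y := y) ⟨h.obstruction, ?_, h.ne, haC, hbC, h.closed, h.light, h.heavy_a, hv,
      fun u hu => (hA hu).1, fun hv => (hA hv).2 rfl, hAc, ?_, fun u hu => (hB hu).1,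
      fun hv => (hB hv).2 rfl, hBc, hdisj, haA, hvA, haB, hbB, hvB, hx, hbx, hy, hxy, hbulk⟩
  · intro T p q hT hne hp hq hpq hpT hqT hcl
    have := h.cut T p q b hne hpq hpT hqT (fun hb => hbC (hT hb)) (by grind)
      (by have := h.ne; grind) hcl
    have : p ∈ ({a, b} : Set V) := this ▸ .inl rfl
    grind
  · intro u hu w hw huw
    have := hAcl u hu w
    grind

theorem conn_diff_of_ne [Finite V] (h : HeavySetting G a b C L) {v x y : V} (hv : v ∈ C)
    (hx : x ∈ C) (hy : y ∈ C) (hxy : x ≠ y) (hbx : G.Adj b x) (hby : G.Adj b y)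
    (hNP : NonPlanar (restrictTo G C ⊔ edge x y)) (hxv : x ≠ v) : IsConnSet G (C \ {v}) := by
  by_contra hcon
  obtain ⟨A, hA, hxA, hAc, hAcl⟩ := exists_component G (X := C \ {v}) (p := x) ⟨hx, hxv⟩
  have hdisj : ∀ B : Set V, B ⊆ C \ {v} → IsConnSet G B → (∃ u ∈ B, u ∉ A) →
      ∀ u ∈ A, u ∉ B := by
    rintro B hB hBc ⟨u, hu, huA⟩ s hsA hsB
    exact huA (hBc.subset_of_closed hsB hsA (fun p hp _ q hq hpq => hAcl p hp q (hB hq) hpq) hu)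
  by_cases hyA : y ∈ A ∨ y = v
  · obtain ⟨u, hu, huA⟩ : ∃ u ∈ C \ {v}, u ∉ A := by
      by_contra! hall
      exact hcon (hA.antisymm hall ▸ hAc)
    obtain ⟨B, hB, huB, hBc, hBcl⟩ := exists_component G hu
    refine h.false_of_bulk hv hA hAc hAcl hB hBc hBcl (hdisj B hB hBc ⟨u, huB, huA⟩) hxA hbx
      (hyA.symm.imp id fun hyA => ⟨hyA, hby⟩) hxy ?_
    rcases hNP.split (insert v A) Aᶜ v v (by grind) (by grind) (fun s t hs ht hst => by
      rw [sup_adj, edge_adj, restrictTo_adj] at hst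
      have := hAcl s (by grind) t
      grind) with h1 | h1
    · refine h1.mono fun s t hst => ?_
      rw [sup_adj, edge_adj, restrictTo_adj, sup_adj, edge_adj, restrictTo_adj] at hst
      rw [sup_adj, edge_adj, restrictTo_adj]
      grind
    · refine (h.planar (h1.mono fun s t hst => ?_)).elim
      rw [sup_adj, edge_adj, restrictTo_adj, sup_adj, edge_adj] at hst
      grind
  · have hyv : y ≠ v := fun e => hyA (.inr e)
    have hyA : y ∉ A := fun e => hyA (.inl e)
    obtain ⟨B, hB, hyB, hBc, hBcl⟩ := exists_component G (X := C \ {v}) (p := y) ⟨hy, hyv⟩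
    have hdisj := hdisj B hB hBc ⟨y, hyB, hyA⟩
    have hvA : v ∉ A := fun e => (hA e).2 rfl
    rcases hNP.split {u | u ∈ A ∨ u = v ∨ u = y} Aᶜ v y (by grind) (by grind)
      (fun s t hs ht hst => by
        rw [sup_adj, edge_adj, restrictTo_adj] at hst
        have := hAcl s (by grind) t
        grind) with h1 | h1
    · refine h.false_of_bulk hv hA hAc hAcl hB hBc hBcl hdisj hxA hbx (y := v) (.inl rfl) hxv
        ((h1.suppress (b := y) (x := x) (y := v) fun u hu => ?_).mono fun s t hst =>
          hst.imp (fun hst => ?_) id)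
      · rw [sup_adj, edge_adj, restrictTo_adj, sup_adj, edge_adj, restrictTo_adj] at hu
        have : ¬ G.Adj y y := G.irrefl
        have : ∀ u ∈ A, ¬ G.Adj y u := fun u hu hyu => hyA (hAcl u hu y ⟨hy, hyv⟩ hyu.symm)
        grind
      · rw [restrictTo_adj, sup_adj, edge_adj, restrictTo_adj, sup_adj, edge_adj,
          restrictTo_adj] at hst
        rw [restrictTo_adj]
        grind
    · rcases h1.split (insert v B) Bᶜ v v (by grind) (by grind) (fun s t hs ht hst => by
        rw [sup_adj, edge_adj, restrictTo_adj, sup_adj, edge_adj, restrictTo_adj] at hst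
        have := hBcl s (by grind) t
        grind) with h2 | h2
      · refine h.false_of_bulk hv hB hBc hBcl hA hAc hAcl (fun u hu hu' => hdisj u hu' hu) hyB hby
          (y := v) (.inl rfl) hyv (h2.mono fun s t hst => ?_)
        rw [sup_adj, edge_adj, restrictTo_adj, sup_adj, edge_adj, restrictTo_adj, sup_adj, edge_adj,
          restrictTo_adj] at hst
        rw [sup_adj, edge_adj, restrictTo_adj]
        grind
      · refine h.planar (h2.mono fun s t hst => ?_)
        rw [sup_adj, edge_adj, restrictTo_adj, sup_adj, edge_adj, restrictTo_adj, sup_adj,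
          edge_adj] at hst
        grind

theorem conn_diff [Finite V] (h : HeavySetting G a b C L) {F : SimpleGraph V} (hF : NonPlanar F)
    (hle : ∀ u w, F.Adj u w → G.Adj u w ∧ u ≠ a ∧ w ≠ a) (hdeg : {w | F.Adj b w}.ncard < 3)
    {v : V} (hv : v ∈ C) : IsConnSet G (C \ {v}) := by
  obtain ⟨x, hx, y, hy, hxy, hbx, hby, hNP⟩ := h.exists_edge hF hle hdeg
  by_cases hxv : x = v
  · rw [edge_comm] at hNP
    exact h.conn_diff_of_ne hv hy hx hxy.symm hby hbx hNP (hxv ▸ hxy.symm)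
  · exact h.conn_diff_of_ne hv hx hy hxy hbx hby hNP hxv

end HeavySetting

theorem isConnSet_of_vConn [Fintype V] {G : SimpleGraph V} (hk : vConn G = 2) :
    IsConnSet G Set.univ ∧ ∀ v, IsConnSet G {v}ᶜ := by
  set S := {k : ℕ | ∀ s : Finset V, s.card < k → (G.induce ((↑s : Set V)ᶜ)).Connected} with hS
  have hk' : sSup S = 2 := hk
  have hbdd : BddAbove S := by
    by_contra hno
    rw [Nat.sSup_of_not_bddAbove hno] at hk'
    omega
  have h2 : 2 ∈ S := hk' ▸ Nat.sSup_mem ⟨0, fun s hs => (Nat.not_lt_zero _ hs).elim⟩ hbdd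
  have h2 : ∀ s : Finset V, s.card < 2 → IsConnSet G (↑s : Set V)ᶜ :=
    fun s hs => (isConnSet_iff _ _).1 (h2 s hs)
  exact ⟨by simpa using h2 ∅ (by simp), fun v => by simpa using h2 {v} (by simp)⟩

theorem isTwoCut_of_closed {G : SimpleGraph V} {T : Set V} {p q l : V} (hne : T.Nonempty)
    (hpq : p ≠ q) (hp : p ∉ T) (hq : q ∉ T) (hl : l ∉ T) (hlp : l ≠ p) (hlq : l ≠ q)
    (hcl : ∀ u ∈ T, ∀ w, G.Adj u w → w ∈ T ∨ w = p ∨ w = q) : IsTwoCut G {p, q} := by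
  refine ⟨Set.ncard_pair hpq, fun hcon => ?_⟩
  obtain ⟨t, ht⟩ := hne
  have htS : t ∈ ({p, q} : Set V)ᶜ := by grind
  have : Nonempty ↑({p, q} : Set V)ᶜ := ⟨⟨t, htS⟩⟩
  have hconn := (isConnSet_iff _ _).1 (Connected.mk hcon)
  refine hl (hconn.subset_of_closed htS ht (fun u hu _ w hw huw => ?_) (by grind))
  have := hcl u hu w huw
  grind

theorem nonPlanar_spanningCoe {G : SimpleGraph V} {H : G.Subgraph} (h : IsKuratowski H) :
    NonPlanar H.spanningCoe := by
  have : NonPlanar H.coe :=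
    h.imp (fun h => h.hasModel isRobust_K5) (fun h => h.hasModel isRobust_K33)
  exact this.map Subtype.val_injective fun u v huv => huv

theorem connected_induce_induce {G : SimpleGraph V} {C : Set V} (u : C)
    (h : IsConnSet G (C \ {u.1})) : ((G.induce C).induce {x | x ≠ u}).Connected := by
  rw [isConnSet_iff]
  obtain ⟨t, ht, htu⟩ := h.1
  refine ⟨⟨⟨t, ht⟩, fun e => htu (congrArg Subtype.val e)⟩, fun T hT hne hcl x hx => ?_⟩
  obtain ⟨s, hs⟩ := hne
  have := h.subset_of_closed (T := Subtype.val '' T) (t := s.1)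
    ⟨s.2, fun e => hT hs (Subtype.ext e)⟩ ⟨s, hs, rfl⟩ (by
      rintro _ ⟨p, hp, rfl⟩ _ q hq hpq
      exact ⟨⟨q, hq.1⟩, hcl p hp ⟨q, hq.1⟩ (fun e => hq.2 (congrArg Subtype.val e)) hpq, rfl⟩)
    (show x.1 ∈ C \ {u.1} from ⟨x.2, fun e => hx (Subtype.ext e)⟩)
  obtain ⟨p, hp, hpx⟩ := this
  exact (Subtype.ext hpx : p = x) ▸ hp

end HeavySide

/-- If `b` is not a branch vertex of some Kuratowski subgraph avoiding `a`, then `G[C]`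
is 2-connected. -/
theorem heavy_side_two_connected {V : Type} [Fintype V] (G : SimpleGraph V) (a b : V) (C L : Set V)
    (hobs : IsApexObstruction G)
    (hk : vConn G = 2)
    (hcut : IsTwoCut G {a, b})
    (huniq : ∀ T : Set V, IsTwoCut G T → T = ({a, b} : Set V))
    (hab : a ≠ b)
    (hheavy : IsHeavyComp G a b C)
    (hlight : IsCompOf G {a, b} L) (hLC : L ≠ C)
    (hplanarC : IsPlanar (G.induce C))
    (Ha : G.Subgraph) (hHa : IsKuratowskiWitness G a Ha)
    (hb : ¬ IsBranchVertex Ha b) :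
    IsTwoConnectedGraph (G.induce C) := by
  obtain ⟨hconn, hconn'⟩ := isConnSet_of_vConn hk
  obtain ⟨⟨hCne, hCd, hCc, hCcl⟩, ⟨Ka, ⟨hKa, haKa⟩, hKaC⟩, ⟨Kb, ⟨hKb, hbKb⟩, hKbC⟩⟩ := hheavy
  obtain ⟨hLne, hLd, hLc, hLcl⟩ := hlight
  rw [isConnSet_iff] at hCc hLc
  have hmem : ∀ u, u ∈ ({a, b} : Set V) ↔ u = a ∨ u = b := fun u => by simp
  have haC : a ∉ C := fun h => Set.disjoint_left.1 hCd h (by simp)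
  have hbC : b ∉ C := fun h => Set.disjoint_left.1 hCd h (by simp)
  have hLS : ∀ u ∈ L, u ∉ ({a, b} : Set V) := fun u hu => Set.disjoint_left.1 hLd hu
  have hCS : ∀ u ∈ C, u ∉ ({a, b} : Set V) := fun u hu => Set.disjoint_left.1 hCd hu
  have hLCd : ∀ u ∈ L, u ∉ C := by
    intro u huL huC
    refine hLC (Set.Subset.antisymm ?_ ?_)
    · exact hLc.subset_of_closed huL huC fun s hs _ t ht hst => hCcl s hs t (hLS t ht) hst
    · exact hCc.subset_of_closed huC huL fun s hs _ t ht hst => hLcl s hs t (hCS t ht) hst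
  have h : HeavySetting G a b C L := by
    refine ⟨hobs, hconn, hconn', fun T p q l h1 h2 h3 h4 h5 h6 h7 h8 =>
      huniq _ (isTwoCut_of_closed h1 h2 h3 h4 h5 h6 h7 h8), hab, haC, hbC,
      fun u hu w huw => ?_, hCc, hLc, fun u hu w huw => ?_, fun u hu => ?_, ?_, ?_, fun hNP => ?_⟩
    · have := hCcl u hu w
      have := hmem w
      tauto
    · have := hLcl u hu w
      have := hmem w
      tauto
    · have := hLS u hu
      have := hLCd u hu
      have := hmem u
      tauto
    · have key : ∀ u ∈ Kb.verts, u ∈ insert a C := by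
        intro u hu
        rcases hKbC hu with h | rfl | rfl
        · exact .inr h
        · exact .inl rfl
        · exact (hbKb hu).elim
      exact (nonPlanar_spanningCoe hKb).mono fun s t hst => restrictTo_adj.2
        ⟨Kb.adj_sub hst, key s (Kb.edge_vert hst), key t (Kb.edge_vert hst.symm)⟩
    · have key : ∀ u ∈ Ka.verts, u ∈ insert b C := by
        intro u hu
        rcases hKaC hu with h | rfl | rfl
        · exact .inr h
        · exact (haKa hu).elim
        · exact .inl rfl
      exact (nonPlanar_spanningCoe hKa).mono fun s t hst => restrictTo_adj.2
        ⟨Ka.adj_sub hst, key s (Ka.edge_vert hst), key t (Ka.edge_vert hst.symm)⟩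
    · exact (not_isPlanar_iff _).2 (nonPlanar_induce hNP fun u v huv => restrictTo_adj.1 huv)
        hplanarC
  constructor
  · have h5 := h.heavy_a.five_le (Set.toFinite _) fun u v huv => (restrictTo_adj.1 huv).2.1
    have := Set.ncard_insert_le a C
    rw [Nat.card_coe_set_eq]
    omega
  · refine fun u => connected_induce_induce u (h.conn_diff (nonPlanar_spanningCoe hHa.1)
      (fun s t hst => ⟨Ha.adj_sub hst, ?_, ?_⟩) ?_ u.2)
    · rintro rfl
      exact hHa.2 (Ha.edge_vert hst)
    · rintro rfl
      exact hHa.2 (Ha.edge_vert hst.symm)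
    · by_contra hdeg
      have hdeg : 3 ≤ (Ha.neighborSet b).ncard := not_lt.1 hdeg
      refine hb ⟨?_, hdeg⟩
      obtain ⟨w, hw⟩ := Set.nonempty_of_ncard_ne_zero (s := Ha.neighborSet b) (by omega)
      exact Ha.edge_vert hw
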